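/- arXiv:2105.07980 — 2 statements merged into one kernel-verified Lean document; each statement's English description precedes it below -/
import Mathlib

section
/- For every m ≥ 1, the topological complexity of the odd-dimensional sphere S^{2m−1} equals 2. -/
open unitInterval

/-- A continuous local motion-planning section over `U ⊆ X × X`. -/
def IsMotionSection {X : Type*} [TopologicalSpace X] (U : Set (X × X)) : Prop :=
  ∃ s : C(U, C(I, X)), ∀ p : U, s p 0 = (p : X × X).1 ∧ s p 1 = (p : X × X).2

/-- `X × X` can be covered by `k` open sets, each admitting a continuous local section. -/
def HasTCCover (X : Type*) [TopologicalSpace X] (k : ℕ) : Prop :=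
  ∃ U : Fin k → Set (X × X), (∀ i, IsOpen (U i)) ∧ (⋃ i, U i) = Set.univ ∧
    ∀ i, IsMotionSection (U i)

/-- Farber's topological complexity (unreduced; `⊤` if no finite cover works). -/
noncomputable def topologicalComplexity (X : Type*) [TopologicalSpace X] : ℕ∞ :=
  sInf ((↑) '' {k : ℕ | 1 ≤ k ∧ HasTCCover X k})


lemma aux_proj_lip {E : Type*} [NormedAddCommGroup E] [NormedSpace ℝ E] (x y : E) :
    ‖(max 1 ‖x‖)⁻¹ • x - (max 1 ‖y‖)⁻¹ • y‖ ≤ 2 * ‖x - y‖ := by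
  set a := max 1 ‖x‖ with ha
  set b := max 1 ‖y‖ with hb
  have ha1 : 1 ≤ a := le_max_left _ _
  have hb1 : 1 ≤ b := le_max_left _ _
  have hyb : ‖y‖ ≤ b := le_max_right _ _
  have hab : |b - a| ≤ ‖x - y‖ := by
    have h1 := abs_max_sub_max_le_max 1 ‖y‖ 1 ‖x‖
    simp only [sub_self, abs_zero] at h1
    rw [norm_sub_rev]
    refine h1.trans (max_le (norm_nonneg _) (abs_norm_sub_norm_le y x))
  have e : a⁻¹ • x - b⁻¹ • y = a⁻¹ • (x - y) + ((b - a) * (a⁻¹ * b⁻¹)) • y := by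
    have : (b - a) * (a⁻¹ * b⁻¹) = a⁻¹ - b⁻¹ := by field_simp
    rw [this, smul_sub, sub_smul]; abel
  have hai : a⁻¹ ≤ 1 := inv_le_one_of_one_le₀ ha1
  have ha0 : 0 ≤ a⁻¹ := by positivity
  have hb0 : b⁻¹ * ‖y‖ ≤ 1 := by
    rw [inv_mul_le_iff₀ (by positivity)]; linarith
  rw [e]
  refine (norm_add_le _ _).trans ?_
  rw [norm_smul, norm_smul, Real.norm_eq_abs, Real.norm_eq_abs, abs_mul, abs_mul,
    abs_of_nonneg ha0, abs_of_nonneg (by positivity : 0 ≤ b⁻¹)]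
  have h1 : a⁻¹ * ‖x - y‖ ≤ ‖x - y‖ := mul_le_of_le_one_left (norm_nonneg _) hai
  have h2 : |b - a| * (a⁻¹ * b⁻¹) * ‖y‖ ≤ ‖x - y‖ := by
    calc |b - a| * (a⁻¹ * b⁻¹) * ‖y‖ = |b - a| * (a⁻¹ * (b⁻¹ * ‖y‖)) := by ring
      _ ≤ |b - a| * 1 := by
        gcongr
        exact mul_le_one₀ hai (by positivity) hb0
      _ ≤ _ := by linarith
  linarith

lemma aux_detpoly {E : Type*} [NormedAddCommGroup E] [NormedSpace ℝ E] [FiniteDimensional ℝ E]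
    (L : E →L[ℝ] E) : ∃ p : Polynomial ℝ, p.degree < (Module.finrank ℝ E + 1 : ℕ) ∧
      ∀ t : ℝ, p.eval t = (ContinuousLinearMap.id ℝ E + t • L).det := by
  classical
  let b := Module.finBasis ℝ E
  let A := LinearMap.toMatrix b b (L : E →ₗ[ℝ] E)
  refine ⟨((Polynomial.X : Polynomial ℝ) • A.map Polynomial.C + (1 : Matrix _ _ ℝ).map Polynomial.C).det, ?_, ?_⟩
  · have := Polynomial.natDegree_det_X_add_C_le A 1
    rw [Fintype.card_fin] at this
    exact (Polynomial.degree_le_of_natDegree_le this).trans_lt (by exact_mod_cast Nat.lt_succ_self _)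
  · intro t
    have : (ContinuousLinearMap.id ℝ E + t • L).det = (1 + t • A).det := by
      rw [ContinuousLinearMap.det, ← LinearMap.det_toMatrix b]
      congr 1
      simp [A, map_add]
    rw [this, ← Polynomial.coe_evalRingHom, RingHom.map_det]
    congr 1
    ext i j
    simp [Matrix.one_apply, add_comm]
    split_ifs <;> simp [mul_comm]

/-- No `C^1` retraction of the ball on the sphere. -/
lemma aux_no_retract {E : Type*} [NormedAddCommGroup E] [InnerProductSpace ℝ E]
    [FiniteDimensional ℝ E] (r : E → E) (hr : ContDiff ℝ 1 r)
    (h1 : ∀ x, ‖r x‖ = 1) (h2 : ∀ x, ‖x‖ = 1 → r x = x) : False := by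
  borelize E
  let μ : MeasureTheory.Measure E := MeasureTheory.Measure.addHaar
  set B := Metric.closedBall (0 : E) 1 with hB
  have hBc : IsCompact B := isCompact_closedBall _ _
  have hBm : MeasurableSet B := hBc.isClosed.measurableSet
  let g : E → E := fun x => r x - x
  have hg : ContDiff ℝ 1 g := hr.sub contDiff_id
  have hgc : Continuous (fderiv ℝ g) := hg.continuous_fderiv one_ne_zero
  have hgd : ∀ x, HasFDerivAt g (fderiv ℝ g x) x := fun x =>
    (hg.differentiable one_ne_zero x).hasFDerivAt
  obtain ⟨C, hC⟩ := hBc.exists_bound_of_continuousOn hgc.continuousOn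
  have hC0 : 0 ≤ C := (norm_nonneg _).trans (hC 0 (by simp [hB]))
  have hlip : ∀ x ∈ B, ∀ y ∈ B, ‖g x - g y‖ ≤ C * ‖x - y‖ := fun x hx y hy =>
    (convex_closedBall (0 : E) 1).norm_image_sub_le_of_norm_fderiv_le
      (fun z _ => (hgd z).differentiableAt) hC hy hx
  -- positivity of determinant
  obtain ⟨δ, hδ, hdet⟩ : ∃ δ > 0, ∀ A : E →L[ℝ] E, ‖A‖ < δ →
      0 < (ContinuousLinearMap.id ℝ E + A).det := by
    have hc : Continuous fun A : E →L[ℝ] E => (ContinuousLinearMap.id ℝ E + A).det :=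
      ContinuousLinearMap.continuous_det.comp (continuous_const.add continuous_id)
    have h0 : {A : E →L[ℝ] E | 0 < (ContinuousLinearMap.id ℝ E + A).det} ∈ nhds 0 := by
      refine (isOpen_lt continuous_const hc).mem_nhds ?_
      simp [ContinuousLinearMap.det]
    obtain ⟨δ, hδ, h⟩ := Metric.mem_nhds_iff.1 h0
    exact ⟨δ, hδ, fun A hA => h (by simpa using hA)⟩
  obtain ⟨t0, ht0, ht01, ht0C, ht0δ⟩ : ∃ t0 > 0, t0 ≤ 1 ∧ t0 * C ≤ 1/4 ∧ t0 * C < δ := by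
    refine ⟨min 1 (min (1/4) (δ/2) / (C + 1)), by positivity, min_le_left _ _, ?_, ?_⟩
    all_goals
      have hh : min 1 (min (1/4) (δ/2) / (C + 1)) * C ≤ min (1/4) (δ/2) := by
        calc _ ≤ (min (1/4) (δ/2) / (C + 1)) * (C + 1) := by
              gcongr
              · exact min_le_right _ _
              · linarith
          _ = _ := by field_simp
    · exact hh.trans (min_le_left _ _)
    · exact hh.trans_lt ((min_le_right _ _).trans_lt (by linarith))
  let J : ℝ → E → ℝ := fun t x => (ContinuousLinearMap.id ℝ E + t • fderiv ℝ g x).det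
  have hJc : ∀ t, Continuous (J t) := fun t =>
    ContinuousLinearMap.continuous_det.comp (continuous_const.add (hgc.const_smul t))
  have hJi : ∀ t, MeasureTheory.IntegrableOn (J t) B μ := fun t =>
    (hJc t).continuousOn.integrableOn_compact hBc
  have key : ∀ t, 0 ≤ t → t ≤ t0 → ∫ x in B, J t x ∂μ = μ.real B := by
    intro t ht htt
    have htC : t * C ≤ 1/4 := (mul_le_mul_of_nonneg_right htt hC0).trans ht0C
    have htδ : t * C < δ := (mul_le_mul_of_nonneg_right htt hC0).trans_lt ht0δ
    let f : E → E := fun x => x + t • g x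
    have hf : ∀ x, HasFDerivAt f (ContinuousLinearMap.id ℝ E + t • fderiv ℝ g x) x := fun x =>
      (hasFDerivAt_id x).add ((hgd x).const_smul t)
    have hinj : Set.InjOn f B := by
      intro x hx y hy hxy
      have e : x - y = t • (g y - g x) := by
        have : x + t • g x = y + t • g y := hxy
        rw [smul_sub, sub_eq_sub_iff_add_eq_add, this, add_comm]
      have h3 : ‖x - y‖ ≤ 1/4 * ‖x - y‖ := by
        calc ‖x - y‖ = t * ‖g y - g x‖ := by rw [e, norm_smul, Real.norm_of_nonneg ht]
          _ ≤ t * (C * ‖y - x‖) := by gcongr; exact hlip y hy x hx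
          _ = t * C * ‖x - y‖ := by rw [norm_sub_rev]; ring
          _ ≤ _ := by gcongr
      have : ‖x - y‖ = 0 := by linarith [norm_nonneg (x - y)]
      exact sub_eq_zero.1 (norm_eq_zero.1 this)
    have himg : f '' B = B := by
      apply Set.Subset.antisymm
      · rintro _ ⟨x, hx, rfl⟩
        have hx' : ‖x‖ ≤ 1 := by simpa [hB] using hx
        have e : f x = (1 - t) • x + t • r x := by
          simp only [f, g, smul_sub, sub_smul, one_smul]; abel
        have : ‖f x‖ ≤ 1 := by
          rw [e]
          refine (norm_add_le _ _).trans ?_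
          rw [norm_smul, norm_smul, h1, Real.norm_of_nonneg ht,
            Real.norm_of_nonneg (by linarith)]
          nlinarith
        simpa [hB] using this
      · intro y hy
        have hy' : ‖y‖ ≤ 1 := by simpa [hB] using hy
        let P : E → E := fun x => (max 1 ‖x‖)⁻¹ • x
        have hPB : ∀ x, P x ∈ B := by
          intro x
          have : ‖P x‖ ≤ 1 := by
            simp only [P, norm_smul, norm_inv, Real.norm_eq_abs]
            rw [abs_of_nonneg (by positivity), inv_mul_le_iff₀ (by positivity)]
            simp
          simpa [hB] using this
        let Φ : E → E := fun x => y - t • g (P x)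
        have hΦ : ContractingWith (1/2) Φ := by
          refine ⟨by rw [← NNReal.coe_lt_coe]; norm_num, LipschitzWith.of_dist_le_mul fun a b => ?_⟩
          rw [dist_eq_norm, dist_eq_norm]
          have e : Φ a - Φ b = t • (g (P b) - g (P a)) := by
            simp only [Φ, smul_sub]; abel
          calc ‖Φ a - Φ b‖ = t * ‖g (P b) - g (P a)‖ := by
                rw [e, norm_smul, Real.norm_of_nonneg ht]
            _ ≤ t * (C * ‖P b - P a‖) := by gcongr; exact hlip _ (hPB b) _ (hPB a)
            _ ≤ t * (C * (2 * ‖b - a‖)) := by gcongr; exact aux_proj_lip b a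
            _ = 2 * (t * C) * ‖a - b‖ := by rw [norm_sub_rev]; ring
            _ ≤ 2 * (1/4) * ‖a - b‖ := by gcongr
            _ = _ := by norm_num
        have hfix : Φ (hΦ.fixedPoint) = hΦ.fixedPoint := hΦ.fixedPoint_isFixedPt
        set x := hΦ.fixedPoint
        have hx1 : ‖x‖ ≤ 1 := by
          by_contra hcon
          push Not at hcon
          have hPn : ‖P x‖ = 1 := by
            simp only [P, norm_smul, norm_inv, Real.norm_eq_abs, max_eq_right hcon.le, abs_norm]
            exact inv_mul_cancel₀ (by positivity)
          have : g (P x) = 0 := by simp only [g]; rw [h2 _ hPn, sub_self]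
          have : x = y := by rw [← hfix]; simp [Φ, this]
          rw [this] at hcon; linarith
        have hPx : P x = x := by simp [P, max_eq_left hx1]
        refine ⟨x, by simpa [hB] using hx1, ?_⟩
        have h5 : y - t • g x = x := by
          have := hfix
          simp only [Φ] at this
          rwa [hPx] at this
        show x + t • g x = y
        rw [← h5]
        nth_rewrite 2 [h5]
        abel
    have hpos : ∀ x ∈ B, 0 < J t x := by
      intro x hx
      apply hdet
      rw [norm_smul, Real.norm_of_nonneg ht]
      exact (mul_le_mul_of_nonneg_left (hC x hx) ht).trans_lt htδ
    have := MeasureTheory.integral_image_eq_integral_abs_det_fderiv_smul μ hBm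
      (fun x _ => (hf x).hasFDerivWithinAt) hinj (fun _ => (1 : ℝ))
    rw [himg] at this
    simp only [smul_eq_mul, mul_one, MeasureTheory.integral_const, MeasureTheory.measureReal_restrict_apply_univ] at this
    rw [this]
    exact MeasureTheory.setIntegral_congr_fun hBm fun x hx => (abs_of_pos (hpos x hx)).symm
  -- interpolation
  set n := Module.finrank ℝ E with hn
  let s : Finset ℕ := Finset.range (n + 1)
  let v : ℕ → ℝ := fun i => t0 / (i + 1)
  have hv0 : ∀ i, 0 ≤ v i := fun i => by positivity
  have hv1 : ∀ i, v i ≤ t0 := fun i => div_le_self ht0.le (by linarith [(Nat.cast_nonneg i : (0:ℝ) ≤ i)])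
  have hvs : Set.InjOn v s := by
    intro i _ j _ hij
    simp only [v] at hij
    rw [div_eq_div_iff (by positivity) (by positivity)] at hij
    have := mul_left_cancel₀ ht0.ne' hij
    have h : (j : ℝ) = i := by linarith
    exact_mod_cast h.symm
  have hinterp : ∀ x, J 1 x = ∑ i ∈ s, J (v i) x * (Lagrange.basis s v i).eval 1 := by
    intro x
    obtain ⟨p, hp, hpe⟩ := aux_detpoly (fderiv ℝ g x)
    have := Lagrange.eq_interpolate (s := s) (v := v) (f := p) hvs (by simpa [s] using hp)
    have h3 := congrArg (Polynomial.eval 1) this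
    rw [Lagrange.interpolate_apply, Polynomial.eval_finsetSum, hpe] at h3
    simp only [Polynomial.eval_mul, Polynomial.eval_C, hpe] at h3
    exact h3
  have hsum : ∑ i ∈ s, (Lagrange.basis s v i).eval 1 = 1 := by
    rw [← Polynomial.eval_finsetSum, Lagrange.sum_basis hvs (by simp [s])]; simp
  have hone : ∫ x in B, J 1 x ∂μ = μ.real B := by
    simp only [hinterp]
    rw [MeasureTheory.integral_finsetSum _ (fun i _ => (hJi (v i)).mul_const _)]
    simp only [MeasureTheory.integral_mul_const, key _ (hv0 _) (hv1 _)]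
    rw [← Finset.mul_sum, hsum, mul_one]
  have hzero : ∀ x, J 1 x = 0 := by
    intro x
    have hd : HasFDerivAt r (ContinuousLinearMap.id ℝ E + (1:ℝ) • fderiv ℝ g x) x := by
      have := (hasFDerivAt_id x).add ((hgd x).const_smul (1:ℝ))
      refine this.congr_of_eventuallyEq (Filter.Eventually.of_forall fun y => ?_)
      simp [g]
    simp only [J]
    set L := ContinuousLinearMap.id ℝ E + (1:ℝ) • fderiv ℝ g x
    have horth : ∀ w, inner ℝ (r x) (L w) = 0 := by
      intro w
      have h6 := hd.inner ℝ hd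
      have h7 : HasFDerivAt (fun y => inner ℝ (r y) (r y)) (0 : E →L[ℝ] ℝ) x := by
        have : (fun y => inner ℝ (r y) (r y)) = fun _ => (1:ℝ) := by
          ext y; rw [real_inner_self_eq_norm_sq, h1]; norm_num
        rw [this]; exact hasFDerivAt_const _ _
      have h8 := congrArg (fun T : E →L[ℝ] ℝ => T w) (h6.unique h7)
      simp [real_inner_comm] at h8
      have h9 := real_inner_comm (L w) (r x)
      linarith
    by_contra hne
    have hu : IsUnit (L : E →ₗ[ℝ] E) := (LinearMap.isUnit_iff_isUnit_det _).2 (isUnit_iff_ne_zero.2 hne)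
    obtain ⟨w, hw⟩ := ((Module.End.isUnit_iff _).1 hu).2 (r x)
    have h10 := horth w
    rw [show L w = r x from hw, real_inner_self_eq_norm_sq, h1] at h10
    norm_num at h10
  simp only [hzero, MeasureTheory.integral_zero] at hone
  have : 0 < μ.real B := by
    refine ENNReal.toReal_pos (Metric.measure_closedBall_pos μ _ one_pos).ne' hBc.measure_lt_top.ne
  linarith

/-- The sphere is not contractible. -/
lemma aux_no_contract {E : Type*} [NormedAddCommGroup E] [InnerProductSpace ℝ E]
    [FiniteDimensional ℝ E] (H : Metric.sphere (0 : E) 1 × I → Metric.sphere (0 : E) 1)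
    (hH : Continuous H) (x0 : Metric.sphere (0 : E) 1)
    (h0 : ∀ x, H (x, 0) = x) (h1 : ∀ x, H (x, 1) = x0) : False := by
  classical
  have hnx : ∀ x : E, x ≠ 0 → ‖x‖⁻¹ • x ∈ Metric.sphere (0 : E) 1 := by
    intro x hx
    simp [norm_smul, inv_mul_cancel₀ (norm_ne_zero_iff.2 hx)]
  let u : E → Metric.sphere (0 : E) 1 := fun x =>
    if hx : x = 0 then x0 else ⟨‖x‖⁻¹ • x, hnx x hx⟩
  have huv : ∀ x, x ≠ 0 → (u x : E) = ‖x‖⁻¹ • x := fun x hx => by simp [u, hx]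
  have huc : ∀ x, x ≠ 0 → ContinuousAt u x := by
    intro x hx
    rw [Topology.IsInducing.subtypeVal.continuousAt_iff]
    have : ContinuousAt (fun x : E => ‖x‖⁻¹ • x) x :=
      (continuous_norm.continuousAt.inv₀ (norm_ne_zero_iff.2 hx)).smul continuousAt_id
    refine this.congr ?_
    filter_upwards [isOpen_ne.mem_nhds hx] with y hy
    exact (huv y hy).symm
  let τ : E → I := fun x => Set.projIcc 0 1 zero_le_one (2 - 4 * ‖x‖)
  have hτ : Continuous τ := continuous_projIcc.comp (by fun_prop)
  let f : E → E := fun x => (H (u x, τ x) : E)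
  have hf1 : ∀ x, ‖f x‖ = 1 := fun x => mem_sphere_zero_iff_norm.1 (H (u x, τ x)).2
  have hfc : Continuous f := by
    rw [continuous_iff_continuousAt]
    intro x
    by_cases hx : x = 0
    · subst hx
      have : f =ᶠ[nhds 0] fun _ => (x0 : E) := by
        filter_upwards [Metric.ball_mem_nhds (0 : E) (by norm_num : (0:ℝ) < 1/4)] with y hy
        have hy' : ‖y‖ < 1/4 := by simpa using hy
        have : τ y = 1 := Set.projIcc_of_right_le _ (by linarith)
        simp [f, this, h1]
      exact continuousAt_const.congr this.symm
    · have h3 : ContinuousAt (fun x => (u x, τ x)) x := (huc x hx).prodMk hτ.continuousAt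
      exact (continuous_subtype_val.comp hH).continuousAt.comp h3
  have hfe : ∀ x : E, 1/2 < ‖x‖ → f x = ‖x‖⁻¹ • x := by
    intro x hx
    have : τ x = 0 := Set.projIcc_of_le_left _ (by linarith)
    have hx0 : x ≠ 0 := by rintro rfl; simp at hx; linarith
    simp [f, this, h0, huv x hx0]
  have hU : IsOpen {x : E | 1/2 < ‖x‖} := isOpen_lt continuous_const continuous_norm
  obtain ⟨G, hG, hGd, hGe, -⟩ := hfc.exists_contDiff_approx_and_eqOn 1 (ε := fun _ => 1)
    continuous_const (fun _ => one_pos) (S := Metric.sphere (0 : E) 1)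
    (U := {x : E | 1/2 < ‖x‖}) Metric.isClosed_sphere
    (hU.mem_nhdsSet.2 fun x hx => by
      have : ‖x‖ = 1 := by simpa using hx
      show 1/2 < ‖x‖
      rw [this]; norm_num)
    (by
      have : ContDiffOn ℝ (1 : ℕ∞) (fun x : E => ‖x‖⁻¹ • x) {x : E | 1/2 < ‖x‖} := by
        intro x hx
        have hx' : 1/2 < ‖x‖ := hx
        have hx0 : x ≠ 0 := by rintro rfl; simp at hx'; linarith
        exact (((contDiffAt_norm ℝ hx0).inv (norm_ne_zero_iff.2 hx0)).smul
          contDiffAt_id).contDiffWithinAt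
      exact this.congr fun x hx => hfe x hx)
  have hG0 : ∀ x, G x ≠ 0 := by
    intro x hx
    have := hGd x
    rw [hx, dist_zero_left, hf1] at this
    exact lt_irrefl _ this
  have hG' : ContDiff ℝ 1 G := hG
  refine aux_no_retract (fun x => ‖G x‖⁻¹ • G x) ?_ ?_ ?_
  · exact ((hG'.norm ℝ hG0).inv (fun x => norm_ne_zero_iff.2 (hG0 x))).smul hG'
  · intro x
    simp [norm_smul, inv_mul_cancel₀ (norm_ne_zero_iff.2 (hG0 x))]
  · intro x hx
    have : G x = x := by
      rw [hGe (by simpa using hx), hfe x (by rw [hx]; norm_num), hx]; simp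
    simp [this, hx]

lemma aux_section {E : Type*} [NormedAddCommGroup E] [NormedSpace ℝ E]
    (c : (Metric.sphere (0 : E) 1 × Metric.sphere (0 : E) 1) × I → E) (hc : Continuous c)
    (h0 : ∀ p, c (p, 0) = p.1) (h1 : ∀ p, c (p, 1) = p.2) :
    IsOpen {p | ∀ t, c (p, t) ≠ 0} ∧ IsMotionSection {p | ∀ t, c (p, t) ≠ 0} := by
  constructor
  · have h : IsClosed (Prod.fst '' {q | c q = 0}) :=
      isClosedMap_fst_of_compactSpace _ (isClosed_eq hc continuous_const)
    have e : {p | ∀ t, c (p, t) ≠ 0} = (Prod.fst '' {q | c q = 0})ᶜ := by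
      ext p; simp
    rw [e]; exact h.isOpen_compl
  · let U := {p | ∀ t, c (p, t) ≠ 0}
    let F : C(U × I, Metric.sphere (0 : E) 1) :=
      ⟨fun q => ⟨‖c (q.1, q.2)‖⁻¹ • c (q.1, q.2), by
        simp [norm_smul, inv_mul_cancel₀ (norm_ne_zero_iff.2 (q.1.2 q.2))]⟩, by
        refine Continuous.subtype_mk ?_ _
        have hcc : Continuous fun q : U × I => c (q.1, q.2) := hc.comp (by fun_prop)
        exact (hcc.norm.inv₀ fun q => norm_ne_zero_iff.2 (q.1.2 q.2)).smul hcc⟩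
    refine ⟨F.curry, fun p => ⟨?_, ?_⟩⟩
    · ext1
      have : ‖(p.1.1 : E)‖ = 1 := by simp
      simp [F, h0]
    · ext1
      simp [F, h1]

lemma aux_J (m : ℕ) : ∃ J : EuclideanSpace ℝ (Fin (2 * m)) → EuclideanSpace ℝ (Fin (2 * m)),
    Continuous J ∧ (∀ x, J (-x) = - J x) ∧ (∀ x, inner ℝ x (J x) = 0) ∧ ∀ x, J x = 0 → x = 0 := by
  let e : Fin 2 × Fin m ≃ Fin (2 * m) := finProdFinEquiv
  let J : EuclideanSpace ℝ (Fin (2 * m)) → EuclideanSpace ℝ (Fin (2 * m)) := fun x =>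
    WithLp.toLp 2 fun i => if (e.symm i).1 = 0 then - x (e (1, (e.symm i).2))
      else x (e (0, (e.symm i).2))
  refine ⟨J, ?_, ?_, ?_, ?_⟩
  · refine (PiLp.continuous_toLp 2 _).comp (continuous_pi fun i => ?_)
    split_ifs <;> fun_prop
  · intro x; ext i
    simp only [J, PiLp.neg_apply]
    split_ifs <;> rfl
  · intro x
    rw [PiLp.inner_apply, ← e.sum_comp, Fintype.sum_prod_type, Fin.sum_univ_two,
      ← Finset.sum_add_distrib]
    refine Finset.sum_eq_zero fun b _ => ?_
    simp [J]; ring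
  · intro x hx
    have h : ∀ q, J x (e q) = 0 := fun q => by rw [hx]; rfl
    ext i
    obtain ⟨⟨a, b⟩, rfl⟩ := e.surjective i
    fin_cases a
    · simpa [J] using h (1, b)
    · simpa [J] using h (0, b)

/-- The topological complexity of an odd sphere `S^{2m-1}` is `2`. -/
theorem tc_odd_sphere (m : ℕ) (hm : 1 ≤ m) :
    topologicalComplexity (Metric.sphere (0 : EuclideanSpace ℝ (Fin (2 * m))) 1) = 2 := by
  have hne : Nonempty (Fin (2 * m)) := ⟨⟨0, by omega⟩⟩
  have hnt : Nontrivial (EuclideanSpace ℝ (Fin (2 * m))) := inferInstance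
  apply le_antisymm
  · refine sInf_le ⟨2, ⟨by norm_num, ?_⟩, rfl⟩
    obtain ⟨J, hJc, hJn, hJo, hJz⟩ := aux_J m
    let S := Metric.sphere (0 : EuclideanSpace ℝ (Fin (2 * m))) 1
    let c : Fin 2 → (S × S) × I → EuclideanSpace ℝ (Fin (2 * m)) := fun i q =>
      (1 - (q.2 : ℝ)) • (q.1.1 : EuclideanSpace ℝ (Fin (2 * m))) + (q.2 : ℝ) • (q.1.2 : EuclideanSpace ℝ (Fin (2 * m)))
        + ((i : ℕ) * ((q.2 : ℝ) * (1 - q.2)) : ℝ) • J (q.1.2)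
    have hs := fun i => aux_section (c i) (by fun_prop) (fun p => by simp [c]) (fun p => by simp [c])
    refine ⟨fun i => {p | ∀ t, c i (p, t) ≠ 0}, fun i => (hs i).1, ?_, fun i => (hs i).2⟩
    rw [Set.eq_univ_iff_forall]
    rintro ⟨x, y⟩
    rw [Set.mem_iUnion]
    have hx : ‖(x : EuclideanSpace ℝ (Fin (2 * m)))‖ = 1 := by simp
    have hy : ‖(y : EuclideanSpace ℝ (Fin (2 * m)))‖ = 1 := by simp
    by_cases hxy : (x : EuclideanSpace ℝ (Fin (2 * m))) = -y
    · refine ⟨1, fun t ht => ?_⟩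
      simp only [c, hxy] at ht
      have h2 := congrArg (fun z => inner ℝ z (J y)) ht
      simp only [inner_add_left, inner_smul_left, inner_neg_left, hJo] at h2
      simp at h2
      have hy0 : (y : EuclideanSpace ℝ (Fin (2 * m))) ≠ 0 := by
        intro h; rw [h] at hy; simp at hy
      rcases h2 with (h | h) | h
      · simp [h] at ht; exact hy0 ht
      · have : (t : ℝ) = 1 := by linarith
        simp [this] at ht; exact hy0 ht
      · exact hy0 (hJz _ h)
    · refine ⟨0, fun t ht => hxy ?_⟩
      simp [c] at ht
      have h3 := eq_neg_of_add_eq_zero_left ht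
      have h4 := congrArg norm h3
      rw [norm_neg, norm_smul, norm_smul, hx, hy, Real.norm_of_nonneg (by linarith [t.2.2]),
        Real.norm_of_nonneg t.2.1] at h4
      have h5 : (t : ℝ) = 1 / 2 := by linarith
      rw [h5, ← smul_neg] at h3
      rw [show (1 : ℝ) - 1 / 2 = 1 / 2 by norm_num] at h3
      exact smul_right_injective _ (by norm_num : (1 / 2 : ℝ) ≠ 0) h3
  · refine le_sInf ?_
    rintro _ ⟨k, ⟨hk, U, -, hU, hs⟩, rfl⟩
    by_contra hlt
    have hk1 : k = 1 := by
      have : k < 2 := by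
        rw [not_le] at hlt
        exact_mod_cast hlt
      omega
    subst hk1
    have hU0 : ∀ p, p ∈ U 0 := by
      intro p
      have : p ∈ ⋃ i, U i := hU ▸ Set.mem_univ p
      obtain ⟨i, hi⟩ := Set.mem_iUnion.1 this
      rwa [Subsingleton.elim i 0] at hi
    obtain ⟨s, hs⟩ := hs 0
    obtain ⟨x0⟩ : Nonempty (Metric.sphere (0 : EuclideanSpace ℝ (Fin (2 * m))) 1) :=
      (NormedSpace.sphere_nonempty.2 zero_le_one).to_subtype
    refine aux_no_contract (fun q => s ⟨(q.1, x0), hU0 _⟩ q.2) ?_ x0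
      (fun x => (hs _).1) (fun x => (hs _).2)
    have h1 : Continuous fun q : Metric.sphere (0 : EuclideanSpace ℝ (Fin (2 * m))) 1 × I =>
        s ⟨(q.1, x0), hU0 _⟩ :=
      s.continuous.comp (Continuous.subtype_mk (by fun_prop) _)
    exact continuous_eval.comp (h1.prodMk continuous_snd)
end

section
/- For every even d ≥ 2, TC(S^d) = 3. -/
open unitInterval

section HI
variable {ι : Type*} [Fintype ι] [DecidableEq ι]

noncomputable def detL : ContinuousMultilinearMap ℝ (fun _ : ι => ι → ℝ) ℝ :=
  { (Matrix.detRowAlternating (R := ℝ) (n := ι)).toMultilinearMap with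
    cont := by
      show Continuous fun M : Matrix ι ι ℝ => M.det
      exact Continuous.matrix_det continuous_id }

lemma detL_apply (M : ι → ι → ℝ) : detL M = Matrix.det (Matrix.of M) := rfl

lemma detL_swap (R : ι → ι → ℝ) (w h : ι → ℝ) {i k : ι} (hik : i ≠ k) :
    detL (Function.update (Function.update R i w) k h)
      = - detL (Function.update (Function.update R k w) i h) := by
  have := (Matrix.detRowAlternating (R := ℝ) (n := ι)).map_swap
    (Function.update (Function.update R k w) i h) hik
  refine Eq.trans ?_ this
  show Matrix.detRowAlternating _ = _
  congr 1
  funext j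
  by_cases h1 : j = i
  · subst h1; simp [hik, hik.symm]
  by_cases h2 : j = k
  · subst h2; simp [hik, hik.symm]
  simp [Equiv.swap_apply_of_ne_of_ne h1 h2, h1, h2]

lemma detL_cramer (R : ι → ι → ℝ) (w : ι → ℝ) :
    ∑ i, detL (Function.update R i w) • R i = detL R • w := by
  have := Matrix.mulVec_cramer (Matrix.of R).transpose w
  rw [Matrix.det_transpose] at this
  rw [detL_apply, ← this]
  ext j
  simp only [Finset.sum_apply, Pi.smul_apply, Matrix.mulVec, dotProduct, Matrix.transpose_apply,
    Matrix.cramer_transpose_apply, smul_eq_mul, Matrix.of_apply]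
  refine Finset.sum_congr rfl fun i _ => ?_
  rw [mul_comm]; rfl

noncomputable def rows (Ξ : (ι → ℝ) → (ι → ℝ)) (x : ι → ℝ) : ι → ι → ℝ :=
  fun i => fderiv ℝ Ξ x (Pi.single i 1)

lemma hasFDerivAt_detL {G : Type*} [NormedAddCommGroup G] [NormedSpace ℝ G]
    {A : ι → G → (ι → ℝ)} {A' : ι → G →L[ℝ] (ι → ℝ)} {x : G}
    (h : ∀ k, HasFDerivAt (A k) (A' k) x) :
    ∃ L : G →L[ℝ] ℝ, HasFDerivAt (fun x => detL (fun k => A k x)) L x ∧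
      ∀ v, L v = ∑ k, detL (Function.update (fun k => A k x) k (A' k v)) := by
  refine ⟨_, HasFDerivAt.multilinear_comp (f := detL (ι := ι)) h, fun v => ?_⟩
  simp

lemma div_identity {Ξ w : (ι → ℝ) → (ι → ℝ)} {g : (ι → ℝ) → ℝ} (hΞ : ContDiff ℝ 2 Ξ)
    (hw : ContDiff ℝ 1 w) (hg : ContDiff ℝ 1 g) (x : ι → ℝ) :
    ∑ i, fderiv ℝ (fun x => g x * detL (Function.update (rows Ξ x) i (w x))) x (Pi.single i 1)
    = ∑ i, fderiv ℝ g x (Pi.single i 1) * detL (Function.update (rows Ξ x) i (w x))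
      + g x * ∑ i, detL (Function.update (rows Ξ x) i (fderiv ℝ w x (Pi.single i 1))) := by
  classical
  have hd1 : ContDiff ℝ 1 (fderiv ℝ Ξ) := hΞ.fderiv_right (by norm_num)
  have hdd : HasFDerivAt (fderiv ℝ Ξ) (fderiv ℝ (fderiv ℝ Ξ) x) x :=
    (hd1.differentiable (by norm_num) x).hasFDerivAt
  have hwd : HasFDerivAt w (fderiv ℝ w x) x := (hw.differentiable (by norm_num) x).hasFDerivAt
  have hgd : HasFDerivAt g (fderiv ℝ g x) x := (hg.differentiable (by norm_num) x).hasFDerivAt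
  set H : ι → ι → (ι → ℝ) := fun i k =>
    fderiv ℝ (fderiv ℝ Ξ) x (Pi.single i 1) (Pi.single k 1) with hH
  have hsymm : ∀ i k, H i k = H k i := by
    intro i k
    have := (hΞ.contDiffAt (x := x)).isSymmSndFDerivAt (by simp)
    exact this _ _
  have key : ∀ i, fderiv ℝ (fun x => g x * detL (Function.update (rows Ξ x) i (w x))) x
      (Pi.single i 1) = fderiv ℝ g x (Pi.single i 1) * detL (Function.update (rows Ξ x) i (w x))
      + g x * (detL (Function.update (rows Ξ x) i (fderiv ℝ w x (Pi.single i 1))) +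
        ∑ k, if k = i then 0 else
          detL (Function.update (Function.update (rows Ξ x) i (w x)) k (H i k))) := by
    intro i
    obtain ⟨L, hL, hLv⟩ := hasFDerivAt_detL
      (A := fun k y => Function.update (rows Ξ y) i (w y) k)
      (A' := fun k => if k = i then fderiv ℝ w x else
        (fderiv ℝ (fderiv ℝ Ξ) x).flip (Pi.single k 1)) (x := x) (by
        intro k
        by_cases hk : k = i
        · subst hk; simpa using hwd
        · simp only [hk, if_false, Function.update_of_ne hk, rows]
          have := hdd.clm_apply (hasFDerivAt_const (Pi.single k (1:ℝ) : ι → ℝ) x)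
          simpa using this)
    have := (hgd.mul hL).fderiv
    have e : (fun x => g x * detL (Function.update (rows Ξ x) i (w x))) =
      (g * fun y => detL (fun k => Function.update (rows Ξ y) i (w y) k)) := rfl
    rw [e, this]
    simp only [add_apply, smul_apply, smul_eq_mul, hLv]
    rw [add_comm, mul_comm]
    congr 2
    have e2 : ∀ k, detL (Function.update (fun k => Function.update (rows Ξ x) i (w x) k) k
        ((if k = i then fderiv ℝ w x else
        (fderiv ℝ (fderiv ℝ Ξ) x).flip (Pi.single k 1)) (Pi.single i 1))) =
        (if k = i then detL (Function.update (rows Ξ x) i (fderiv ℝ w x (Pi.single i 1))) else 0)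
        + (if k = i then 0 else
          detL (Function.update (Function.update (rows Ξ x) i (w x)) k (H i k))) := by
      intro k
      by_cases hk : k = i
      · subst hk; simp
      · simp [hk, hH]
    rw [Finset.sum_congr rfl fun k _ => e2 k, Finset.sum_add_distrib]
    simp
  rw [Finset.sum_congr rfl fun i _ => key i, Finset.sum_add_distrib, ← Finset.mul_sum,
    Finset.sum_add_distrib]
  set S := ∑ i, ∑ k, if k = i then (0:ℝ) else
          detL (Function.update (Function.update (rows Ξ x) i (w x)) k (H i k)) with hS
  have : S = -S := by
    conv_lhs => rw [hS, Finset.sum_comm]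
    rw [hS, ← Finset.sum_neg_distrib]
    refine Finset.sum_congr rfl fun i _ => ?_
    rw [← Finset.sum_neg_distrib]
    refine Finset.sum_congr rfl fun k _ => ?_
    by_cases hk : k = i
    · simp [hk]
    · rw [if_neg hk, if_neg (Ne.symm hk), detL_swap _ _ _ hk, hsymm k i]
  have : S = 0 := by linarith
  rw [this, add_zero]

lemma integral_fderiv_zero {W : (ι → ℝ) → ℝ} (hW : ContDiff ℝ 1 W) (hc : HasCompactSupport W)
    (v : ι → ℝ) : ∫ x, fderiv ℝ W x v = 0 := by
  have hcd : Continuous fun x => fderiv ℝ W x v :=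
    (hW.continuous_fderiv (by norm_num)).clm_apply continuous_const
  have := integral_mul_fderiv_eq_neg_fderiv_mul_of_integrable (𝕜 := ℝ) (μ := MeasureTheory.volume)
    (f := fun _ : ι → ℝ => (1:ℝ)) (g := W) (v := v) (by simp)
    (by simpa using hcd.integrable_of_hasCompactSupport (hc.fderiv_apply (𝕜 := ℝ) v))
    (by simpa using hW.continuous.integrable_of_hasCompactSupport hc)
    (fun x _ => by fun_prop) (fun x _ => hW.differentiable (by norm_num) x)
  simpa using this

lemma contDiff_rows {Ξ : (ι → ℝ) → (ι → ℝ)} (hΞ : ContDiff ℝ 2 Ξ) (k : ι) :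
    ContDiff ℝ 1 fun x => rows Ξ x k :=
  (hΞ.fderiv_right (m := 1) (by norm_num)).clm_apply contDiff_const

lemma contDiff_detL_update {Ξ w : (ι → ℝ) → (ι → ℝ)} (hΞ : ContDiff ℝ 2 Ξ)
    (hw : ContDiff ℝ 1 w) (i : ι) :
    ContDiff ℝ 1 fun x => detL (Function.update (rows Ξ x) i (w x)) := by
  refine (detL (ι := ι)).contDiff.comp ?_
  refine contDiff_pi.2 fun k => ?_
  by_cases hk : k = i
  · subst hk; simpa using hw
  · simpa [Function.update_of_ne hk] using contDiff_rows hΞ k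

theorem homotopy_invariance {Φ Ψ : (ι → ℝ) → (ι → ℝ)} {β χ : (ι → ℝ) → ℝ}
    (hΦ : ContDiff ℝ 2 Φ) (hΨ : ContDiff ℝ 2 Ψ) (hβ : ContDiff ℝ 1 β) (hχ : ContDiff ℝ 1 χ)
    (hc : HasCompactSupport χ)
    (h0 : ∀ τ : ℝ, 0 ≤ τ → τ ≤ 1 → ∀ x, fderiv ℝ χ x ≠ 0 → β (Φ x + τ • (Ψ x - Φ x)) = 0) :
    ∫ x, χ x * β (Φ x) * detL (rows Φ x) = ∫ x, χ x * β (Ψ x) * detL (rows Ψ x) := by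
  classical
  set w : (ι → ℝ) → (ι → ℝ) := fun x => Ψ x - Φ x with hw_def
  have hw : ContDiff ℝ 2 w := hΨ.sub hΦ
  have hw1 : ContDiff ℝ 1 w := hw.of_le (by norm_num)
  set X : ℝ → (ι → ℝ) → (ι → ℝ) := fun τ x => Φ x + τ • w x with hX_def
  have hX : ∀ τ, ContDiff ℝ 2 (X τ) := fun τ => hΦ.add (hw.const_smul τ)
  have hXd : ∀ τ x, fderiv ℝ (X τ) x = fderiv ℝ Φ x + τ • fderiv ℝ w x := by
    intro τ x
    have h1 := (hΦ.differentiable (by norm_num) x).hasFDerivAt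
    have h2 := (hw.differentiable (by norm_num) x).hasFDerivAt
    exact (h1.add (h2.const_smul τ)).fderiv
  have hrows : ∀ τ x, rows (X τ) x = fun k => rows Φ x k + τ • rows w x k := by
    intro τ x; funext k; simp [rows, hXd]
  set J : ℝ → (ι → ℝ) → ℝ := fun τ x => χ x * β (X τ x) * detL (rows (X τ) x) with hJ
  set J' : ℝ → (ι → ℝ) → ℝ := fun τ x => χ x * (fderiv ℝ β (X τ x) (w x) * detL (rows (X τ) x)
    + β (X τ x) * ∑ k, detL (Function.update (rows (X τ) x) k (rows w x k))) with hJ'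
  have hder : ∀ x τ, HasDerivAt (fun τ => J τ x) (J' τ x) τ := by
    intro x τ
    have hXt : HasDerivAt (fun τ => X τ x) (w x) τ := by
      simpa [hX_def] using ((hasDerivAt_id τ).smul_const (w x)).const_add (Φ x)
    have hb : HasDerivAt (fun τ => β (X τ x)) (fderiv ℝ β (X τ x) (w x)) τ :=
      ((hβ.differentiable (by norm_num) (X τ x)).hasFDerivAt).comp_hasDerivAt τ hXt
    obtain ⟨L, hL, hLv⟩ := hasFDerivAt_detL (G := ℝ)
      (A := fun k τ => rows (X τ) x k)
      (A' := fun k => ContinuousLinearMap.toSpanSingleton ℝ (rows w x k)) (x := τ) (by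
        intro k
        have : HasDerivAt (fun τ => rows (X τ) x k) (rows w x k) τ := by
          simp only [hrows]
          simpa using ((hasDerivAt_id τ).smul_const (rows w x k)).const_add (rows Φ x k)
        exact this.hasFDerivAt)
    have hL1 : HasDerivAt (fun τ => detL (rows (X τ) x)) (L 1) τ := hL.hasDerivAt
    have := (hb.const_mul (χ x)).mul hL1
    refine this.congr_deriv ?_
    rw [hLv]
    simp only [hJ', ContinuousLinearMap.toSpanSingleton_apply, one_smul]
    ring
  have hdiv : ∀ τ, 0 ≤ τ → τ ≤ 1 → ∀ x, J' τ x = ∑ i, fderiv ℝ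
      (fun x => (χ x * β (X τ x)) * detL (Function.update (rows (X τ) x) i (w x))) x
        (Pi.single i 1) := by
    intro τ h1 h2 x
    have hg : ContDiff ℝ 1 fun x => χ x * β (X τ x) :=
      hχ.mul (hβ.comp ((hX τ).of_le (by norm_num)))
    rw [div_identity (hX τ) hw1 hg x]
    have hgd : ∀ i, fderiv ℝ (fun x => χ x * β (X τ x)) x (Pi.single i 1)
        = χ x * fderiv ℝ β (X τ x) (rows (X τ) x i) := by
      intro i
      have a1 := (hχ.differentiable (by norm_num) x).hasFDerivAt
      have a2 := ((hβ.differentiable (by norm_num) (X τ x)).hasFDerivAt).comp x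
        (((hX τ).differentiable (by norm_num) x).hasFDerivAt)
      have a3 := (a1.mul a2).fderiv
      have e : (fun x => χ x * β (X τ x)) = χ * (β ∘ X τ) := rfl
      rw [e, a3]
      have : (β ∘ X τ) x • fderiv ℝ χ x = 0 := by
        by_cases hz : fderiv ℝ χ x = 0
        · simp [hz]
        · have := h0 τ h1 h2 x hz
          have : (β ∘ X τ) x = 0 := this
          rw [this, zero_smul]
      rw [this]
      simp [rows]
    simp only [hgd]
    have : ∑ i, χ x * fderiv ℝ β (X τ x) (rows (X τ) x i) *
        detL (Function.update (rows (X τ) x) i (w x))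
        = χ x * fderiv ℝ β (X τ x) (detL (rows (X τ) x) • w x) := by
      rw [← detL_cramer, map_sum, Finset.mul_sum]
      refine Finset.sum_congr rfl fun i _ => ?_
      rw [map_smul, smul_eq_mul]; ring
    rw [this, map_smul, smul_eq_mul]
    simp only [hJ', rows]
    ring
  have hint0 : ∀ τ, 0 ≤ τ → τ ≤ 1 → ∫ x, J' τ x = 0 := by
    intro τ h1 h2
    have hW : ∀ i, ContDiff ℝ 1 fun x =>
        (χ x * β (X τ x)) * detL (Function.update (rows (X τ) x) i (w x)) := fun i =>
      (hχ.mul (hβ.comp ((hX τ).of_le (by norm_num)))).mul (contDiff_detL_update (hX τ) hw1 i)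
    have hWc : ∀ i, HasCompactSupport fun x =>
        (χ x * β (X τ x)) * detL (Function.update (rows (X τ) x) i (w x)) := fun i =>
      (hc.mul_right).mul_right
    simp only [hdiv τ h1 h2]
    rw [MeasureTheory.integral_finsetSum]
    · exact Finset.sum_eq_zero fun i _ => integral_fderiv_zero (hW i) (hWc i) _
    · intro i _
      refine Continuous.integrable_of_hasCompactSupport ?_ ((hWc i).fderiv_apply (𝕜 := ℝ) _)
      exact ((hW i).continuous_fderiv (by norm_num)).clm_apply continuous_const
  -- joint continuity
  have cR : ∀ k, Continuous fun p : ℝ × (ι → ℝ) => rows (X p.1) p.2 k := by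
    intro k
    simp only [hrows]
    have c1 := (contDiff_rows hΦ k).continuous
    have c2 := (contDiff_rows hw k).continuous
    fun_prop
  have cX : Continuous fun p : ℝ × (ι → ℝ) => X p.1 p.2 := by
    have c1 := hΦ.continuous
    have c2 := hw.continuous
    fun_prop
  have cdet : ∀ k, Continuous fun p : ℝ × (ι → ℝ) =>
      detL (Function.update (rows (X p.1) p.2) k (rows w p.2 k)) := by
    intro k
    refine (detL (ι := ι)).cont.comp (continuous_pi fun j => ?_)
    by_cases hj : j = k
    · subst hj
      simp only [Function.update_self]
      exact (contDiff_rows hw j).continuous.comp continuous_snd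
    · simpa [Function.update_of_ne hj] using cR j
  have cJ' : Continuous fun p : ℝ × (ι → ℝ) => J' p.1 p.2 := by
    have c1 := hχ.continuous.comp (continuous_snd (X := ℝ) (Y := ι → ℝ))
    have c2 : Continuous fun p : ℝ × (ι → ℝ) => fderiv ℝ β (X p.1 p.2) (w p.2) :=
      ((hβ.continuous_fderiv (by norm_num)).comp cX).clm_apply (hw.continuous.comp continuous_snd)
    have c3 : Continuous fun p : ℝ × (ι → ℝ) => detL (rows (X p.1) p.2) :=
      (detL (ι := ι)).cont.comp (continuous_pi cR)
    have c4 := hβ.continuous.comp cX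
    exact c1.mul ((c2.mul c3).add (c4.mul (continuous_finsetSum _ fun k _ => cdet k)))
  have cJ : ∀ τ, Continuous (J τ) := by
    intro τ
    have c3 : Continuous fun x : (ι → ℝ) => detL (rows (X τ) x) :=
      (detL (ι := ι)).cont.comp (continuous_pi fun k => (contDiff_rows (hX τ) k).continuous)
    exact (hχ.continuous.mul (hβ.continuous.comp (hX τ).continuous)).mul c3
  have iJ : ∀ τ, MeasureTheory.Integrable (J τ) := fun τ =>
    (cJ τ).integrable_of_hasCompactSupport (hc.mul_right.mul_right)
  have hftc : ∀ x, J 1 x - J 0 x = ∫ τ in (0:ℝ)..1, J' τ x := by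
    intro x
    refine (intervalIntegral.integral_eq_sub_of_hasDerivAt (fun τ _ => hder x τ) ?_).symm
    exact (cJ'.comp (by fun_prop : Continuous fun τ : ℝ => (τ, x))).intervalIntegrable _ _
  have hsw : ∫ τ in (0:ℝ)..1, ∫ x, J' τ x = ∫ x, ∫ τ in (0:ℝ)..1, J' τ x := by
    apply MeasureTheory.intervalIntegral_integral_swap
    have hK : IsCompact (Set.uIcc (0:ℝ) 1 ×ˢ tsupport χ) := isCompact_uIcc.prod hc
    have i1 := (cJ'.continuousOn (s := (Set.uIcc (0:ℝ) 1 ×ˢ tsupport χ))).integrableOn_compact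
      (μ := MeasureTheory.volume) hK
    have i2 : MeasureTheory.IntegrableOn (fun p : ℝ × (ι → ℝ) => J' p.1 p.2)
        (Set.uIoc (0:ℝ) 1 ×ˢ Set.univ) := by
      refine MeasureTheory.IntegrableOn.of_forall_sdiff_eq_zero
        (s := Set.uIoc (0:ℝ) 1 ×ˢ tsupport χ) ?_ ?_ ?_
      · exact i1.mono_set (Set.prod_mono Set.uIoc_subset_uIcc le_rfl)
      · exact measurableSet_uIoc.prod MeasurableSet.univ
      · rintro ⟨τ, x⟩ ⟨⟨h1, _⟩, h2⟩
        have : x ∉ tsupport χ := fun h => h2 ⟨h1, h⟩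
        simp [hJ', image_eq_zero_of_notMem_tsupport this]
    rw [MeasureTheory.IntegrableOn, MeasureTheory.Measure.volume_eq_prod,
      ← MeasureTheory.Measure.prod_restrict, MeasureTheory.Measure.restrict_univ] at i2
    exact i2
  have h3 : ∫ τ in (0:ℝ)..1, ∫ x, J' τ x = 0 := by
    rw [intervalIntegral.integral_congr (g := fun _ => (0:ℝ))]
    · simp
    · intro τ hτ
      rw [Set.uIcc_of_le zero_le_one] at hτ
      exact hint0 τ hτ.1 hτ.2
  have h4 : ∫ x, (J 1 x - J 0 x) = 0 := by
    simp only [hftc]; rw [← hsw, h3]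
  rw [MeasureTheory.integral_sub (iJ 1) (iJ 0)] at h4
  have e0 : X 0 = Φ := by funext x; simp [hX_def]
  have e1 : X 1 = Ψ := by funext x; simp [hX_def, hw_def]
  simp only [hJ, e0, e1] at h4
  linarith

end HI


section Det
variable {m : Type*} [Fintype m] [DecidableEq m]
open Matrix

lemma det_smul_one_add (α : ℝ) (hα : α ≠ 0) (u w : m → ℝ) :
    det (α • (1 : Matrix m m ℝ) + vecMulVec u w) = α ^ Fintype.card m * (1 + α⁻¹ * (w ⬝ᵥ u)) := by
  have h : α • (1 : Matrix m m ℝ) + vecMulVec u w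
      = α • (1 + replicateCol Unit (α⁻¹ • u) * replicateRow Unit w) := by
    rw [smul_add]
    congr 1
    ext i j
    simp [vecMulVec, Matrix.mul_apply]
    field_simp
  rw [h, det_smul, det_one_add_replicateCol_mul_replicateRow, dotProduct_smul, smul_eq_mul]

lemma det_J2 : det (fromBlocks (0 : Matrix m m ℝ) (-1) 1 (0 : Matrix m m ℝ)) = 1 := by
  have h : fromBlocks (0 : Matrix m m ℝ) (-1) 1 (0 : Matrix m m ℝ)
      = fromBlocks 1 (-1) 0 1 * fromBlocks 1 0 1 1 * fromBlocks 1 (-1) 0 1 := by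
    simp [fromBlocks_multiply]
  rw [h, det_mul, det_mul]
  simp [det_fromBlocks_zero₂₁, det_fromBlocks_zero₁₂]

lemma det_antidiag (a b : ℝ) (ha : a ≠ 0) (A D : Matrix m m ℝ) (hm : Odd (Fintype.card m)) :
    det (fromBlocks A (a • (1 : Matrix m m ℝ)) (b • (1 : Matrix m m ℝ)) D)
      = - (a ^ Fintype.card m * det (b • (1 : Matrix m m ℝ) - a⁻¹ • (D * A))) := by
  have h : det (fromBlocks A (a • (1 : Matrix m m ℝ)) (b • (1 : Matrix m m ℝ)) D *
      fromBlocks (0 : Matrix m m ℝ) (-1) 1 (0 : Matrix m m ℝ) *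
      fromBlocks 1 (a⁻¹ • A) 0 1)
      = a ^ Fintype.card m * det (-(b • (1 : Matrix m m ℝ) - a⁻¹ • (D * A))) := by
    rw [fromBlocks_multiply, fromBlocks_multiply]
    simp only [Matrix.mul_zero, Matrix.mul_one, Matrix.zero_mul, zero_add, add_zero, mul_neg, neg_mul]
    rw [show (a • (1 : Matrix m m ℝ)) * (a⁻¹ • A) + -A = 0 by simp [ha], det_fromBlocks_zero₁₂]
    congr 1
    · simp [det_smul]
    · congr 1
      simp [sub_eq_add_neg, add_comm]
  rw [det_mul, det_mul, det_J2, det_fromBlocks_zero₂₁] at h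
  simp only [det_one, mul_one] at h
  rw [h, det_neg, hm.neg_one_pow]
  ring

/-- the Jacobian matrix -/
noncomputable def jm (a1 a1' b1 b1' a2 a2' b2 b2' : ℝ) (u v : m → ℝ) : Matrix (m ⊕ m) (m ⊕ m) ℝ :=
  fromBlocks (a1 • 1 + vecMulVec u ((2 * a1') • u + (2 * b1') • v)) (a2 • 1) (b1 • 1)
    (b2 • 1 + vecMulVec v ((2 * a2') • u + (2 * b2') • v))

lemma jm_i {a1 a1' b2 b2' : ℝ} {u v : m → ℝ} (ha : 0 < a1) (ha' : a1 + 2 * a1' * (u ⬝ᵥ u) < 0)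
    (hb : 0 < b2) (hb' : 0 ≤ b2') : det (jm a1 a1' 0 0 0 0 b2 b2' u v) < 0 := by
  have hv : 0 ≤ v ⬝ᵥ v := by
    simp only [dotProduct]; exact Finset.sum_nonneg fun i _ => mul_self_nonneg _
  simp only [jm, zero_smul, mul_zero, add_zero, zero_add]
  rw [det_fromBlocks_zero₁₂, det_smul_one_add _ ha.ne', det_smul_one_add _ hb.ne']
  simp only [smul_dotProduct, smul_eq_mul]
  have h1 : 1 + a1⁻¹ * (2 * a1' * (u ⬝ᵥ u)) < 0 := by
    have : 1 + a1⁻¹ * (2 * a1' * (u ⬝ᵥ u)) = a1⁻¹ * (a1 + 2 * a1' * (u ⬝ᵥ u)) := by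
      field_simp
    rw [this]; exact mul_neg_of_pos_of_neg (inv_pos.2 ha) ha'
  have h2 : 0 < 1 + b2⁻¹ * (2 * b2' * (v ⬝ᵥ v)) := by positivity
  exact mul_neg_of_neg_of_pos (mul_neg_of_pos_of_neg (by positivity) h1) (by positivity)

lemma jm_ii {b1 b1' a2 a2' : ℝ} {u v : m → ℝ} (hm : Odd (Fintype.card m)) (ha : 0 < a2)
    (ha' : a2' ≤ 0) (hb : 0 < b1) (hb' : 0 ≤ b1') : det (jm 0 0 b1 b1' a2 a2' 0 0 u v) < 0 := by
  have hv : 0 ≤ v ⬝ᵥ v := by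
    simp only [dotProduct]; exact Finset.sum_nonneg fun i _ => mul_self_nonneg _
  have hu : 0 ≤ u ⬝ᵥ u := by
    simp only [dotProduct]; exact Finset.sum_nonneg fun i _ => mul_self_nonneg _
  simp only [jm, zero_smul, mul_zero, add_zero, zero_add]
  rw [det_antidiag _ _ ha.ne' _ _ hm]
  have e : b1 • (1 : Matrix m m ℝ) - a2⁻¹ • (vecMulVec v ((2 * a2') • u) * vecMulVec u ((2 * b1') • v))
    = b1 • (1 : Matrix m m ℝ) + vecMulVec v ((-(a2⁻¹ * (2 * a2') * (2 * b1') * (u ⬝ᵥ u))) • v) := by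
    rw [vecMulVec_mul_vecMulVec, sub_eq_add_neg]
    congr 1
    ext i j
    simp [vecMulVec]
    ring
  rw [e, det_smul_one_add _ hb.ne', smul_dotProduct, smul_eq_mul]
  have h1 : 0 ≤ -(a2⁻¹ * (2 * a2') * (2 * b1') * (u ⬝ᵥ u)) := by
    have : 0 ≤ a2⁻¹ * (2 * (-a2')) * (2 * b1') * (u ⬝ᵥ u) := by
      have := neg_nonneg.2 ha'
      positivity
    linarith
  have : 0 < a2 ^ Fintype.card m * (b1 ^ Fintype.card m *
    (1 + b1⁻¹ * (-(a2⁻¹ * (2 * a2') * (2 * b1') * (u ⬝ᵥ u)) * (v ⬝ᵥ v)))) := by positivity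
  linarith

lemma jm_iii [Nontrivial m] (a1 a1' a2 a2' : ℝ) (u v : m → ℝ) :
    det (jm a1 a1' 0 0 a2 a2' 0 0 u v) = 0 := by
  simp only [jm, zero_smul, mul_zero, add_zero, zero_add]
  rw [det_fromBlocks_zero₂₁, det_vecMulVec, mul_zero]

lemma jm_iv [Nontrivial m] (b1 b1' b2 b2' : ℝ) (u v : m → ℝ) :
    det (jm 0 0 b1 b1' 0 0 b2 b2' u v) = 0 := by
  simp only [jm, zero_smul, mul_zero, add_zero, zero_add]
  rw [det_fromBlocks_zero₁₂, det_vecMulVec, zero_mul]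

/-- profile functions -/
noncomputable def pa (ρ : ℝ) : ℝ := expNegInvGlue (2 - ρ)
noncomputable def pb (ρ : ℝ) : ℝ := expNegInvGlue (ρ - 2)
noncomputable def pa' (ρ : ℝ) : ℝ := -(((2 - ρ)⁻¹) ^ 2 * expNegInvGlue (2 - ρ))
noncomputable def pb' (ρ : ℝ) : ℝ := ((ρ - 2)⁻¹) ^ 2 * expNegInvGlue (ρ - 2)

lemma hasDerivAt_eng (x : ℝ) : HasDerivAt expNegInvGlue ((x⁻¹) ^ 2 * expNegInvGlue x) x := by
  simpa using expNegInvGlue.hasDerivAt_polynomial_eval_inv_mul 1 x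

lemma hasDerivAt_pa (ρ : ℝ) : HasDerivAt pa (pa' ρ) ρ := by
  have := (hasDerivAt_eng (2 - ρ)).comp ρ ((hasDerivAt_id ρ).const_sub 2)
  exact this.congr_deriv (by simp [pa'])

lemma hasDerivAt_pb (ρ : ℝ) : HasDerivAt pb (pb' ρ) ρ := by
  have := (hasDerivAt_eng (ρ - 2)).comp ρ ((hasDerivAt_id ρ).sub_const 2)
  exact this.congr_deriv (by simp [pb'])

lemma contDiff_pa : ContDiff ℝ 2 pa :=
  (expNegInvGlue.contDiff (n := 2)).comp (contDiff_const.sub contDiff_id)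
lemma contDiff_pb : ContDiff ℝ 2 pb :=
  (expNegInvGlue.contDiff (n := 2)).comp (contDiff_id.sub contDiff_const)

lemma pa_zero {ρ : ℝ} (h : 2 ≤ ρ) : pa ρ = 0 := expNegInvGlue.zero_of_nonpos (by linarith)
lemma pa'_zero {ρ : ℝ} (h : 2 ≤ ρ) : pa' ρ = 0 := by
  simp [pa', expNegInvGlue.zero_of_nonpos (show 2 - ρ ≤ 0 by linarith)]
lemma pb_zero {ρ : ℝ} (h : ρ ≤ 2) : pb ρ = 0 := expNegInvGlue.zero_of_nonpos (by linarith)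
lemma pb'_zero {ρ : ℝ} (h : ρ ≤ 2) : pb' ρ = 0 := by
  simp [pb', expNegInvGlue.zero_of_nonpos (show ρ - 2 ≤ 0 by linarith)]
lemma pa_pos {ρ : ℝ} (h : ρ < 2) : 0 < pa ρ := expNegInvGlue.pos_of_pos (by linarith)
lemma pb_pos {ρ : ℝ} (h : 2 < ρ) : 0 < pb ρ := expNegInvGlue.pos_of_pos (by linarith)
lemma pa'_nonpos (ρ : ℝ) : pa' ρ ≤ 0 := by
  have := expNegInvGlue.nonneg (2 - ρ)
  simp only [pa']
  have : 0 ≤ ((2 - ρ)⁻¹) ^ 2 * expNegInvGlue (2 - ρ) := by positivity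
  linarith
lemma pb'_nonneg (ρ : ℝ) : 0 ≤ pb' ρ := by
  have := expNegInvGlue.nonneg (ρ - 2)
  simp only [pb']
  positivity
lemma pa_neg {ρ : ℝ} (h1 : 1 ≤ ρ) (h2 : ρ < 2) : pa ρ + 2 * pa' ρ * ρ < 0 := by
  have hp := expNegInvGlue.pos_of_pos (show 0 < 2 - ρ by linarith)
  have h3 : 1 ≤ ((2 - ρ)⁻¹) ^ 2 := by
    have : 1 ≤ (2 - ρ)⁻¹ := by
      rw [one_le_inv₀ (by linarith)]; linarith
    nlinarith
  simp only [pa, pa']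
  have h4 : 1 ≤ ((2 - ρ)⁻¹) ^ 2 * ρ := by nlinarith
  nlinarith
lemma pa_lb {ρ : ℝ} (h : ρ ≤ 5/4) : expNegInvGlue (3/4) ≤ pa ρ :=
  expNegInvGlue.monotone (by linarith)
lemma pb_lb {ρ : ℝ} (h : 11/4 ≤ ρ) : expNegInvGlue (3/4) ≤ pb ρ :=
  expNegInvGlue.monotone (by linarith)

lemma jm_nonpos [Nontrivial m] (hm : Odd (Fintype.card m)) (u v : m → ℝ) (hu : 1 ≤ u ⬝ᵥ u)  :
    det (jm (pa (u ⬝ᵥ u)) (pa' (u ⬝ᵥ u)) (pb (u ⬝ᵥ u)) (pb' (u ⬝ᵥ u))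
      (pa (v ⬝ᵥ v)) (pa' (v ⬝ᵥ v)) (pb (v ⬝ᵥ v)) (pb' (v ⬝ᵥ v)) u v) ≤ 0 := by
  rcases le_or_gt (u ⬝ᵥ u) 2 with h1 | h1 <;> rcases le_or_gt (v ⬝ᵥ v) 2 with h2 | h2
  · rw [pb_zero h1, pb'_zero h1, pb_zero h2, pb'_zero h2, jm_iii]
  · rw [pb_zero h1, pb'_zero h1, pa_zero h2.le, pa'_zero h2.le]
    rcases h1.lt_or_eq with h1 | h1
    · exact (jm_i (pa_pos h1) (pa_neg hu h1) (pb_pos h2) (pb'_nonneg _)).le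
    · rw [pa_zero h1.ge, pa'_zero h1.ge]
      have := jm_iv 0 0 (pb (v ⬝ᵥ v)) (pb' (v ⬝ᵥ v)) u v
      exact this.le
  · rw [pb_zero h2, pb'_zero h2, pa_zero h1.le, pa'_zero h1.le]
    rcases h2.lt_or_eq with h2 | h2
    · exact (jm_ii hm (pa_pos h2) (pa'_nonpos _) (pb_pos h1) (pb'_nonneg _)).le
    · rw [pa_zero h2.ge, pa'_zero h2.ge]
      exact (jm_iv _ _ 0 0 u v).le
  · rw [pa_zero h1.le, pa'_zero h1.le, pa_zero h2.le, pa'_zero h2.le, jm_iv]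

/-- model map -/
noncomputable def Psi (x : m ⊕ m → ℝ) : m ⊕ m → ℝ :=
  Sum.elim
    (fun j => pa (∑ i, x (.inl i) ^ 2) * x (.inl j) + pb (∑ i, x (.inl i) ^ 2) * x (.inr j))
    (fun j => pa (∑ i, x (.inr i) ^ 2) * x (.inl j) + pb (∑ i, x (.inr i) ^ 2) * x (.inr j))

lemma contDiff_Psi : ContDiff ℝ 2 (Psi (m := m)) := by
  have hcoord : ∀ k : m ⊕ m, ContDiff ℝ 2 fun x : m ⊕ m → ℝ => x k := fun k => contDiff_apply _ _ k
  have h1 : ContDiff ℝ 2 fun x : m ⊕ m → ℝ => ∑ i, x (.inl i) ^ 2 :=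
    ContDiff.sum fun i _ => (hcoord _).pow 2
  have h2 : ContDiff ℝ 2 fun x : m ⊕ m → ℝ => ∑ i, x (.inr i) ^ 2 :=
    ContDiff.sum fun i _ => (hcoord _).pow 2
  refine contDiff_pi.2 fun k => ?_
  rcases k with j | j
  · exact ((contDiff_pa.comp h1).mul (hcoord _)).add ((contDiff_pb.comp h1).mul (hcoord _))
  · exact ((contDiff_pa.comp h2).mul (hcoord _)).add ((contDiff_pb.comp h2).mul (hcoord _))

lemma fderiv_Psi (x h : m ⊕ m → ℝ) : fderiv ℝ Psi x h = Sum.elim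
    (fun j => pa (∑ i, x (.inl i) ^ 2) * h (.inl j) + pb (∑ i, x (.inl i) ^ 2) * h (.inr j)
      + (2 * ∑ i, x (.inl i) * h (.inl i)) * (pa' (∑ i, x (.inl i) ^ 2) * x (.inl j)
        + pb' (∑ i, x (.inl i) ^ 2) * x (.inr j)))
    (fun j => pa (∑ i, x (.inr i) ^ 2) * h (.inl j) + pb (∑ i, x (.inr i) ^ 2) * h (.inr j)
      + (2 * ∑ i, x (.inr i) * h (.inr i)) * (pa' (∑ i, x (.inr i) ^ 2) * x (.inl j)
        + pb' (∑ i, x (.inr i) ^ 2) * x (.inr j))) := by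
  have hd : DifferentiableAt ℝ (Psi (m := m)) x := contDiff_Psi.differentiable (by norm_num) x
  rw [← hd.lineDeriv_eq_fderiv]
  refine HasLineDerivAt.lineDeriv ?_
  have hc : ∀ k, HasDerivAt (fun t : ℝ => (x + t • h) k) (h k) 0 := by
    intro k
    simpa using ((hasDerivAt_id (0:ℝ)).mul_const (h k)).const_add (x k)
  have hs : ∀ f : m → m ⊕ m, HasDerivAt (fun t : ℝ => ∑ i, ((x + t • h) (f i)) ^ 2)
      (2 * ∑ i, x (f i) * h (f i)) 0 := by
    intro f
    have := HasDerivAt.fun_sum (u := Finset.univ) fun i _ => ((hc (f i)).pow 2)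
    refine this.congr_deriv ?_
    rw [Finset.mul_sum]
    refine Finset.sum_congr rfl fun i _ => ?_
    simp; ring
  have hpa : ∀ f : m → m ⊕ m, HasDerivAt (fun t : ℝ => pa (∑ i, ((x + t • h) (f i)) ^ 2))
      (pa' (∑ i, x (f i) ^ 2) * (2 * ∑ i, x (f i) * h (f i))) 0 := by
    intro f
    refine HasDerivAt.comp (0:ℝ) (h₂ := pa) ?_ (hs f)
    simpa using hasDerivAt_pa (∑ i, x (f i) ^ 2)
  have hpb : ∀ f : m → m ⊕ m, HasDerivAt (fun t : ℝ => pb (∑ i, ((x + t • h) (f i)) ^ 2))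
      (pb' (∑ i, x (f i) ^ 2) * (2 * ∑ i, x (f i) * h (f i))) 0 := by
    intro f
    refine HasDerivAt.comp (0:ℝ) (h₂ := pb) ?_ (hs f)
    simpa using hasDerivAt_pb (∑ i, x (f i) ^ 2)
  refine hasDerivAt_pi.2 fun k => ?_
  have hmain : ∀ (f : m → m ⊕ m) (j : m), HasDerivAt (fun t : ℝ =>
      pa (∑ i, ((x + t • h) (f i)) ^ 2) * (x + t • h) (.inl j)
      + pb (∑ i, ((x + t • h) (f i)) ^ 2) * (x + t • h) (.inr j))
      (pa (∑ i, x (f i) ^ 2) * h (.inl j) + pb (∑ i, x (f i) ^ 2) * h (.inr j)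
      + (2 * ∑ i, x (f i) * h (f i)) * (pa' (∑ i, x (f i) ^ 2) * x (.inl j)
        + pb' (∑ i, x (f i) ^ 2) * x (.inr j))) 0 := by
    intro f j
    refine (((hpa f).mul (hc (.inl j))).add ((hpb f).mul (hc (.inr j)))).congr_deriv ?_
    simp
    ring
  rcases k with j | j
  · exact hmain _ j
  · exact hmain _ j

lemma rows_Psi (x : m ⊕ m → ℝ) :
    (Matrix.of fun i => fderiv ℝ Psi x (Pi.single i 1)) =
      jm (pa (∑ i, x (.inl i) ^ 2)) (pa' (∑ i, x (.inl i) ^ 2)) (pb (∑ i, x (.inl i) ^ 2))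
        (pb' (∑ i, x (.inl i) ^ 2)) (pa (∑ i, x (.inr i) ^ 2)) (pa' (∑ i, x (.inr i) ^ 2))
        (pb (∑ i, x (.inr i) ^ 2)) (pb' (∑ i, x (.inr i) ^ 2))
        (fun i => x (.inl i)) (fun i => x (.inr i)) := by
  ext k l
  rw [Matrix.of_apply, fderiv_Psi]
  rcases k with k | k <;> rcases l with l | l <;>
    simp [jm, vecMulVec, Matrix.one_apply, Pi.single_apply, eq_comm] <;> ring

end Det

section Main
open Matrix

lemma lb_aux {n : ℕ} (hn : 0 < n) {w p r : Fin n → ℝ} {ε c c0 τ : ℝ} (hc0 : 0 < c0)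
    (hw1 : 1 ≤ ∑ i, w i ^ 2) (hw3 : ∑ i, w i ^ 2 ≤ 3) (hε : 4 * n * ε ≤ 1)
    (hp : ∀ j, |p j - (Real.sqrt (∑ i, w i ^ 2))⁻¹ * w j| ≤ ε) (hc : c0 ≤ c)
    (h0 : 0 ≤ τ) (h1 : τ ≤ 1) (hr : ∀ j, r j = p j + τ * (c * w j - p j)) :
    ∃ j, min (1/2) c0 / (2 * n) ≤ |r j| := by
  by_contra hcon
  push Not at hcon
  have hn' : (0:ℝ) < n := by exact_mod_cast hn
  haveI : Nonempty (Fin n) := ⟨⟨0, hn⟩⟩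
  set N := ∑ i, w i ^ 2 with hN
  have hwj : ∀ j, |w j| ≤ 2 := by
    intro j
    have : w j ^ 2 ≤ N := Finset.single_le_sum (f := fun i => w i ^ 2)
      (fun i _ => sq_nonneg _) (Finset.mem_univ j)
    exact abs_le_of_sq_le_sq (by nlinarith) (by norm_num)
  have hs1 : 1 ≤ Real.sqrt N := Real.one_le_sqrt.2 hw1
  have e1 : ∑ j, (Real.sqrt N)⁻¹ * w j * w j = Real.sqrt N := by
    have : ∀ j, (Real.sqrt N)⁻¹ * w j * w j = (Real.sqrt N)⁻¹ * (w j ^ 2) := fun j => by ring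
    simp only [this]
    rw [← Finset.mul_sum, ← hN]
    have h2 : Real.sqrt N * Real.sqrt N = N := Real.mul_self_sqrt (by linarith)
    field_simp
    nlinarith
  have e2 : Real.sqrt N - 1 / 2 ≤ ∑ j, p j * w j := by
    have h3 : ∀ j, (Real.sqrt N)⁻¹ * w j * w j - 2 * ε ≤ p j * w j := by
      intro j
      have ha : |(p j - (Real.sqrt N)⁻¹ * w j) * w j| ≤ ε * 2 := by
        rw [abs_mul]
        exact mul_le_mul (hp j) (hwj j) (abs_nonneg _) ((abs_nonneg _).trans (hp j))
      have := (abs_le.1 ha).1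
      nlinarith
    have h4 := Finset.sum_le_sum fun j (_ : j ∈ Finset.univ) => h3 j
    rw [Finset.sum_sub_distrib, e1] at h4
    simp at h4
    nlinarith
  have e3 : ∑ j, r j * w j = (1 - τ) * ∑ j, p j * w j + τ * c * N := by
    rw [hN, Finset.mul_sum, Finset.mul_sum, ← Finset.sum_add_distrib]
    refine Finset.sum_congr rfl fun j _ => ?_
    rw [hr]; ring
  have e4 : ∑ j, r j * w j < ∑ _j : Fin n, 2 * (min (1/2) c0 / (2 * n)) := by
    refine Finset.sum_lt_sum_of_nonempty Finset.univ_nonempty fun j _ => ?_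
    have : r j * w j ≤ |r j| * 2 := by
      calc r j * w j ≤ |r j * w j| := le_abs_self _
        _ = |r j| * |w j| := abs_mul _ _
        _ ≤ |r j| * 2 := by gcongr; exact hwj j
    have := hcon j
    linarith
  have e5 : ∑ _j : Fin n, 2 * (min (1/2) c0 / (2 * n)) = min (1/2) c0 := by
    simp; field_simp
  have h6 : min (1/2) c0 ≤ (1 - τ) * ∑ j, p j * w j + τ * c * N := by
    have a1 : min (1/2) c0 ≤ ∑ j, p j * w j := (min_le_left _ _).trans (by linarith)
    have a2 : min (1/2) c0 ≤ c * N := (min_le_right _ _).trans (by nlinarith)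
    nlinarith
  linarith

abbrev Sph (d : ℕ) := Metric.sphere (0 : EuclideanSpace ℝ (Fin (d + 1))) 1

noncomputable def dir {d : ℕ} (u : Fin (d + 1) → ℝ) : EuclideanSpace ℝ (Fin (d + 1)) :=
  (Real.sqrt (∑ i, u i ^ 2))⁻¹ • WithLp.toLp 2 u

lemma dir_mem {d : ℕ} {u : Fin (d + 1) → ℝ} (hu : 1 ≤ ∑ i, u i ^ 2) :
    dir u ∈ Metric.sphere (0 : EuclideanSpace ℝ (Fin (d + 1))) 1 := by
  have : 1 ≤ Real.sqrt (∑ i, u i ^ 2) := Real.one_le_sqrt.2 hu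
  rw [mem_sphere_zero_iff_norm, dir, norm_smul, EuclideanSpace.norm_eq]
  simp only [Real.norm_eq_abs, sq_abs]
  rw [abs_of_nonneg (by positivity)]
  exact inv_mul_cancel₀ (by linarith)

theorem no_pair (d : ℕ) (hd : 2 ≤ d) (heven : Even d)
    (G0 G1 : (Sph d × Sph d) × ℝ → EuclideanSpace ℝ (Fin (d + 1)))
    (c0 : Continuous G0) (c1 : Continuous G1)
    (s0 : ∀ p t, t ≤ 0 → G0 (p, t) = p.1) (s1 : ∀ p t, t ≤ 0 → G1 (p, t) = p.1)
    (e0 : ∀ p t, 1 ≤ t → G0 (p, t) = p.2) (e1 : ∀ p t, 1 ≤ t → G1 (p, t) = p.2)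
    (hne : ∀ p s t, G0 (p, s) ≠ 0 ∨ G1 (p, t) ≠ 0) : False := by
  classical
  set n := d + 1 with hn_def
  let V := Fin n ⊕ Fin n → ℝ
  let Nu : V → ℝ := fun x => ∑ i, x (.inl i) ^ 2
  let Nv : V → ℝ := fun x => ∑ i, x (.inr i) ^ 2
  have dNu : ContDiff ℝ 2 Nu := ContDiff.sum fun i _ => (contDiff_apply ℝ ℝ (Sum.inl i)).pow 2
  have dNv : ContDiff ℝ 2 Nv := ContDiff.sum fun i _ => (contDiff_apply ℝ ℝ (Sum.inr i)).pow 2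
  let K : Set V := {x | (1 ≤ Nu x ∧ Nu x ≤ 3) ∧ (1 ≤ Nv x ∧ Nv x ≤ 3)}
  have hKcl : IsClosed K := by
    have a1 := dNu.continuous
    have a2 := dNv.continuous
    exact ((isClosed_le continuous_const a1).inter (isClosed_le a1 continuous_const)).inter
      ((isClosed_le continuous_const a2).inter (isClosed_le a2 continuous_const))
  have hKc : IsCompact K := by
    refine (isCompact_closedBall (0 : V) 2).of_isClosed_subset hKcl ?_
    rintro x ⟨⟨_, h1⟩, _, h2⟩
    rw [mem_closedBall_zero_iff, pi_norm_le_iff_of_nonneg (by norm_num)]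
    rintro (k | k)
    · have : x (.inl k) ^ 2 ≤ Nu x := Finset.single_le_sum (f := fun i => x (.inl i) ^ 2)
        (fun i _ => sq_nonneg _) (Finset.mem_univ k)
      exact abs_le_of_sq_le_sq (by nlinarith) (by norm_num)
    · have : x (.inr k) ^ 2 ≤ Nv x := Finset.single_le_sum (f := fun i => x (.inr i) ^ 2)
        (fun i _ => sq_nonneg _) (Finset.mem_univ k)
      exact abs_le_of_sq_le_sq (by nlinarith) (by norm_num)
  let du : K → Sph d := fun x => ⟨dir fun i => x.1 (.inl i), dir_mem x.2.1.1⟩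
  let dv : K → Sph d := fun x => ⟨dir fun i => x.1 (.inr i), dir_mem x.2.2.1⟩
  have cdu : Continuous du := by
    refine Continuous.subtype_mk ?_ _
    have h1 : Continuous fun x : K => (Real.sqrt (∑ i, x.1 (.inl i) ^ 2))⁻¹ := by
      refine Continuous.inv₀ (Real.continuous_sqrt.comp
        (dNu.continuous.comp continuous_subtype_val)) fun x => ?_
      have : 1 ≤ Real.sqrt (Nu x.1) := Real.one_le_sqrt.2 x.2.1.1
      exact (by linarith : (0:ℝ) < Real.sqrt (Nu x.1)).ne'
    have h2 : Continuous fun x : K =>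
        (WithLp.toLp 2 fun i => x.1 (.inl i) : EuclideanSpace ℝ (Fin n)) :=
      (PiLp.continuous_toLp 2 _).comp (continuous_pi fun i =>
        (continuous_apply (Sum.inl i)).comp continuous_subtype_val)
    exact h1.smul h2
  have cdv : Continuous dv := by
    refine Continuous.subtype_mk ?_ _
    have h1 : Continuous fun x : K => (Real.sqrt (∑ i, x.1 (.inr i) ^ 2))⁻¹ := by
      refine Continuous.inv₀ (Real.continuous_sqrt.comp
        (dNv.continuous.comp continuous_subtype_val)) fun x => ?_
      have : 1 ≤ Real.sqrt (Nv x.1) := Real.one_le_sqrt.2 x.2.2.1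
      exact (by linarith : (0:ℝ) < Real.sqrt (Nv x.1)).ne'
    have h2 : Continuous fun x : K =>
        (WithLp.toLp 2 fun i => x.1 (.inr i) : EuclideanSpace ℝ (Fin n)) :=
      (PiLp.continuous_toLp 2 _).comp (continuous_pi fun i =>
        (continuous_apply (Sum.inr i)).comp continuous_subtype_val)
    exact h1.smul h2
  let sg : ℝ → ℝ := fun ρ => (ρ - 5/4) * (2/3)
  have csg : Continuous sg := by fun_prop
  let F : C(K, V) := ⟨fun x => Sum.elim (fun j => G0 ((du x, dv x), sg (Nu x.1)) j)
    (fun j => G1 ((du x, dv x), sg (Nv x.1)) j), by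
      have cNu : Continuous fun x : K => sg (Nu x.1) :=
        csg.comp (dNu.continuous.comp continuous_subtype_val)
      have cNv : Continuous fun x : K => sg (Nv x.1) :=
        csg.comp (dNv.continuous.comp continuous_subtype_val)
      refine continuous_pi ?_
      rintro (j | j)
      · have := c0.comp ((cdu.prodMk cdv).prodMk cNu)
        exact (EuclideanSpace.proj (𝕜 := ℝ) j).continuous.comp this
      · have := c1.comp ((cdu.prodMk cdv).prodMk cNv)
        exact (EuclideanSpace.proj (𝕜 := ℝ) j).continuous.comp this⟩
  have hFne : ∀ x, F x ≠ 0 := by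
    intro x hx
    rcases hne (du x, dv x) (sg (Nu x.1)) (sg (Nv x.1)) with h | h
    · apply h; ext j; exact congrFun hx (.inl j)
    · apply h; ext j; exact congrFun hx (.inr j)
  obtain ⟨F1, hF1⟩ := ContinuousMap.exists_restrict_eq hKcl F
  have hF1' : ∀ x (hx : x ∈ K), F1 x = F ⟨x, hx⟩ := fun x hx => by rw [← hF1]; rfl
  obtain ⟨ε0, hε0, hε0le⟩ := hKc.exists_forall_le' (f := fun x => ‖F1 x‖) (a := 0)
    (by fun_prop) (fun x hx => by
      rw [hF1' x hx]; exact norm_pos_iff.2 (hFne _))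
  set κ0 := expNegInvGlue (3/4) with hκ0
  have hκ0p : 0 < κ0 := expNegInvGlue.pos_of_pos (by norm_num)
  have hnp : (0:ℝ) < n := by positivity
  set κ := min (1/2) κ0 / (2 * (n:ℝ)) with hκ
  have hκp : 0 < κ := by positivity
  set ε := min (ε0 / 2) (1 / (4 * (n:ℝ))) with hε
  have hεp : 0 < ε := by positivity
  have hε1 : 4 * (n:ℝ) * ε ≤ 1 := by
    have : ε ≤ 1 / (4 * (n:ℝ)) := min_le_right _ _
    calc 4 * (n:ℝ) * ε ≤ 4 * (n:ℝ) * (1 / (4 * (n:ℝ))) := by gcongr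
      _ = 1 := by field_simp
  obtain ⟨Φ, hΦ, hΦF, -⟩ := F1.continuous.exists_contDiff_approx 2 (ε := fun _ => ε)
    continuous_const (fun _ => hεp)
  have hΦF' : ∀ x k, |Φ x k - F1 x k| ≤ ε := by
    intro x k
    have := (hΦF x).le
    rw [dist_eq_norm] at this
    exact (norm_le_pi_norm (Φ x - F1 x) k).trans this
  set r := min (ε0 / 2) κ with hr
  have hrp : 0 < r := by positivity
  let β : ContDiffBump (0 : V) := ⟨r / 2, r, by positivity, by linarith⟩
  have hβ0 : ∀ y : V, r ≤ ‖y‖ → β y = 0 := fun y hy => β.zero_of_le_dist (by simpa using hy)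
  let χ1 : ContDiffBump (2 : ℝ) := ⟨3/4, 1, by norm_num, by norm_num⟩
  let χ : V → ℝ := fun x => χ1 (Nu x) * χ1 (Nv x)
  have hχd : ContDiff ℝ 1 χ :=
    ((χ1.contDiff (n := 1)).comp (dNu.of_le (by norm_num))).mul
      ((χ1.contDiff (n := 1)).comp (dNv.of_le (by norm_num)))
  have hχ1 : ∀ ρ, χ1 ρ ≠ 0 → 1 ≤ ρ ∧ ρ ≤ 3 := by
    intro ρ h
    have h2 : ρ ∈ Function.support χ1 := h
    rw [χ1.support_eq, Metric.mem_ball, Real.dist_eq, abs_lt] at h2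
    have : χ1.rOut = 1 := rfl
    constructor <;> linarith [h2.1, h2.2]
  have hχK : ∀ x, x ∉ K → χ x = 0 := by
    intro x hx
    by_contra h
    exact hx ⟨hχ1 _ (left_ne_zero_of_mul h), hχ1 _ (right_ne_zero_of_mul h)⟩
  have hχc : HasCompactSupport χ := HasCompactSupport.intro hKc hχK
  have hχt : tsupport χ ⊆ K := closure_minimal (fun x hx => by
    by_contra h; exact hx (hχK x h)) hKcl
  have hmid : ∀ x, fderiv ℝ χ x ≠ 0 → x ∈ K ∧
      (Nu x ≤ 5/4 ∨ 11/4 ≤ Nu x ∨ Nv x ≤ 5/4 ∨ 11/4 ≤ Nv x) := by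
    intro x hx
    refine ⟨hχt (support_fderiv_subset ℝ hx), ?_⟩
    by_contra hcon
    push Not at hcon
    apply hx
    obtain ⟨h1, h2, h3, h4⟩ := hcon
    have : χ =ᶠ[nhds x] fun _ => (1:ℝ) := by
      have a1 := dNu.continuous.continuousAt.eventually (Ioo_mem_nhds h1 h2)
      have a2 := dNv.continuous.continuousAt.eventually (Ioo_mem_nhds h3 h4)
      have hone : ∀ ρ ∈ Set.Ioo (5/4:ℝ) (11/4), χ1 ρ = 1 := by
        intro ρ hρ
        apply χ1.one_of_mem_closedBall
        rw [Metric.mem_closedBall, Real.dist_eq]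
        show |ρ - 2| ≤ 3/4
        rw [abs_le]
        constructor <;> linarith [hρ.1, hρ.2]
      filter_upwards [a1, a2] with y hy1 hy2
      simp only [χ]
      rw [hone _ hy1, hone _ hy2, one_mul]
    rw [this.fderiv_eq]; simp
  have h0 : ∀ τ : ℝ, 0 ≤ τ → τ ≤ 1 → ∀ x, fderiv ℝ χ x ≠ 0 →
      β (Φ x + τ • (Psi x - Φ x)) = 0 := by
    intro τ ht0 ht1 x hx
    obtain ⟨hxK, hcase⟩ := hmid x hx
    apply hβ0
    set y : V := Φ x + τ • (Psi x - Φ x) with hy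
    suffices ∃ k, κ ≤ |y k| by
      obtain ⟨k, hk⟩ := this
      exact (min_le_right _ _).trans (hk.trans (norm_le_pi_norm y k))
    have hxK' := hxK
    obtain ⟨⟨u1, u3⟩, v1, v3⟩ := hxK'
    rcases hcase with h | h | h | h
    · obtain ⟨j, hj⟩ := lb_aux (n := n) (by omega) (w := fun i => x (.inl i))
        (p := fun i => Φ x (.inl i)) (r := fun i => y (.inl i)) (c := pa (Nu x)) hκ0p u1 u3 hε1
        (by
          intro j
          have := hΦF' x (.inl j)
          rw [hF1' x hxK] at this
          have e : F ⟨x, hxK⟩ (.inl j) = (Real.sqrt (∑ i, x (.inl i) ^ 2))⁻¹ * x (.inl j) := by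
            show G0 ((du ⟨x, hxK⟩, dv ⟨x, hxK⟩), sg (Nu x)) j = _
            rw [s0 _ _ (by simp only [sg]; linarith)]
            rfl
          rwa [e] at this) (pa_lb h) ht0 ht1 (by
          intro j
          show Φ x (.inl j) + τ * ((pa (Nu x) * x (.inl j) + pb (Nu x) * x (.inr j))
            - Φ x (.inl j)) = _
          rw [pb_zero (by linarith)]; ring)
      exact ⟨_, hj⟩
    · obtain ⟨j, hj⟩ := lb_aux (n := n) (by omega) (w := fun i => x (.inr i))
        (p := fun i => Φ x (.inl i)) (r := fun i => y (.inl i)) (c := pb (Nu x)) hκ0p v1 v3 hε1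
        (by
          intro j
          have := hΦF' x (.inl j)
          rw [hF1' x hxK] at this
          have e : F ⟨x, hxK⟩ (.inl j) = (Real.sqrt (∑ i, x (.inr i) ^ 2))⁻¹ * x (.inr j) := by
            show G0 ((du ⟨x, hxK⟩, dv ⟨x, hxK⟩), sg (Nu x)) j = _
            rw [e0 _ _ (by simp only [sg]; linarith)]
            rfl
          rwa [e] at this) (pb_lb h) ht0 ht1 (by
          intro j
          show Φ x (.inl j) + τ * ((pa (Nu x) * x (.inl j) + pb (Nu x) * x (.inr j))
            - Φ x (.inl j)) = _
          rw [pa_zero (by linarith)]; ring)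
      exact ⟨_, hj⟩
    · obtain ⟨j, hj⟩ := lb_aux (n := n) (by omega) (w := fun i => x (.inl i))
        (p := fun i => Φ x (.inr i)) (r := fun i => y (.inr i)) (c := pa (Nv x)) hκ0p u1 u3 hε1
        (by
          intro j
          have := hΦF' x (.inr j)
          rw [hF1' x hxK] at this
          have e : F ⟨x, hxK⟩ (.inr j) = (Real.sqrt (∑ i, x (.inl i) ^ 2))⁻¹ * x (.inl j) := by
            show G1 ((du ⟨x, hxK⟩, dv ⟨x, hxK⟩), sg (Nv x)) j = _
            rw [s1 _ _ (by simp only [sg]; linarith)]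
            rfl
          rwa [e] at this) (pa_lb h) ht0 ht1 (by
          intro j
          show Φ x (.inr j) + τ * ((pa (Nv x) * x (.inl j) + pb (Nv x) * x (.inr j))
            - Φ x (.inr j)) = _
          rw [pb_zero (by linarith)]; ring)
      exact ⟨_, hj⟩
    · obtain ⟨j, hj⟩ := lb_aux (n := n) (by omega) (w := fun i => x (.inr i))
        (p := fun i => Φ x (.inr i)) (r := fun i => y (.inr i)) (c := pb (Nv x)) hκ0p v1 v3 hε1
        (by
          intro j
          have := hΦF' x (.inr j)
          rw [hF1' x hxK] at this
          have e : F ⟨x, hxK⟩ (.inr j) = (Real.sqrt (∑ i, x (.inr i) ^ 2))⁻¹ * x (.inr j) := by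
            show G1 ((du ⟨x, hxK⟩, dv ⟨x, hxK⟩), sg (Nv x)) j = _
            rw [e1 _ _ (by simp only [sg]; linarith)]
            rfl
          rwa [e] at this) (pb_lb h) ht0 ht1 (by
          intro j
          show Φ x (.inr j) + τ * ((pa (Nv x) * x (.inl j) + pb (Nv x) * x (.inr j))
            - Φ x (.inr j)) = _
          rw [pa_zero (by linarith)]; ring)
      exact ⟨_, hj⟩
  have hHI := homotopy_invariance (Φ := Φ) (Ψ := Psi) (β := β) (χ := χ) hΦ contDiff_Psi
    (β.contDiff (n := 1)) hχd hχc h0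
  have hL : ∫ x, χ x * β (Φ x) * detL (rows Φ x) = 0 := by
    have : ∀ x, χ x * β (Φ x) * detL (rows Φ x) = 0 := by
      intro x
      by_cases hx : x ∈ K
      · have h1 := hε0le x hx
        have h2 := (hΦF x).le
        rw [dist_eq_norm] at h2
        have h3 : ‖F1 x‖ ≤ ‖Φ x‖ + ‖Φ x - F1 x‖ := by
          have := norm_sub_le (Φ x) (Φ x - F1 x)
          simpa using this
        have h4 : ε ≤ ε0 / 2 := min_le_left _ _
        have h5 : r ≤ ε0 / 2 := min_le_left _ _
        rw [hβ0 (Φ x) (by linarith)]; simp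
      · rw [hχK x hx]; simp
    simp [this]
  have hnt : Nontrivial (Fin n) := Fin.nontrivial_iff_two_le.2 (by omega)
  have hodd : Odd (Fintype.card (Fin n)) := by
    rw [Fintype.card_fin]; exact heven.add_one
  have hdot : ∀ w : Fin n → ℝ, w ⬝ᵥ w = ∑ i, w i ^ 2 := by
    intro w; simp [dotProduct, sq]
  have hdet : ∀ x : V, detL (rows Psi x) = det (jm (pa (Nu x)) (pa' (Nu x)) (pb (Nu x))
      (pb' (Nu x)) (pa (Nv x)) (pa' (Nv x)) (pb (Nv x)) (pb' (Nv x))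
      (fun i => x (.inl i)) (fun i => x (.inr i))) := by
    intro x
    rw [← rows_Psi]; rfl
  let f : V → ℝ := fun x => -(χ x * β (Psi x) * detL (rows Psi x))
  have hfc : Continuous f := by
    have a3 : Continuous fun x : V => detL (rows Psi x) :=
      (detL (ι := Fin n ⊕ Fin n)).cont.comp
        (continuous_pi fun k => (contDiff_rows contDiff_Psi k).continuous)
    exact ((hχd.continuous.mul (β.continuous.comp contDiff_Psi.continuous)).mul a3).neg
  have hfs : HasCompactSupport f := by
    refine HasCompactSupport.intro hKc fun x hx => ?_
    simp [f, hχK x hx]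
  have hf0 : 0 ≤ f := by
    intro x
    show (0:ℝ) ≤ f x
    by_cases hx : x ∈ K
    · have h1 : detL (rows Psi x) ≤ 0 := by
        rw [hdet]
        have := jm_nonpos hodd (fun i => x (.inl i)) (fun i => x (.inr i)) (by
          rw [hdot]; exact hx.1.1)
        rw [hdot, hdot] at this
        exact this
      have h2 : 0 ≤ χ x * β (Psi x) := mul_nonneg (mul_nonneg χ1.nonneg χ1.nonneg) β.nonneg
      simp only [f]
      nlinarith
    · simp [f, hχK x hx]
  let z : ℝ → V := fun δ => Sum.elim (Pi.single 0 (Real.sqrt (2 - δ)))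
    (Pi.single 0 (Real.sqrt (2 + δ)))
  have hz : Continuous z := by
    refine continuous_pi ?_
    rintro (j | j)
    · by_cases hj : j = 0
      · subst hj; simp only [z, Sum.elim_inl, Pi.single_eq_same]; fun_prop
      · simp only [z, Sum.elim_inl, Pi.single_eq_of_ne hj]; fun_prop
    · by_cases hj : j = 0
      · subst hj; simp only [z, Sum.elim_inr, Pi.single_eq_same]; fun_prop
      · simp only [z, Sum.elim_inr, Pi.single_eq_of_ne hj]; fun_prop
  have hsing : ∀ a : ℝ, 0 ≤ a → ∑ i : Fin n, (Pi.single 0 (Real.sqrt a) : Fin n → ℝ) i ^ 2 = a := by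
    intro a ha
    rw [Finset.sum_eq_single 0]
    · simp [Real.sq_sqrt ha]
    · intro b _ hb; simp [Pi.single_eq_of_ne hb]
    · simp
  have hzu : ∀ δ, δ ≤ 2 → Nu (z δ) = 2 - δ := fun δ hδ => hsing _ (by linarith)
  have hzv : ∀ δ, 0 ≤ δ → Nv (z δ) = 2 + δ := fun δ hδ => hsing _ (by linarith)
  have hPz : Psi (z 0) = 0 := by
    funext k
    rcases k with k | k
    · show pa (Nu (z 0)) * _ + pb (Nu (z 0)) * _ = 0
      rw [hzu 0 (by norm_num), pa_zero (by norm_num), pb_zero (by norm_num)]; ring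
    · show pa (Nv (z 0)) * _ + pb (Nv (z 0)) * _ = 0
      rw [hzv 0 le_rfl, pa_zero (by norm_num), pb_zero (by norm_num)]; ring
  have hev : ∀ᶠ δ in nhds (0:ℝ), ‖Psi (z δ)‖ < r := by
    have hcont : Continuous fun δ => ‖Psi (z δ)‖ := (contDiff_Psi.continuous.comp hz).norm
    refine hcont.continuousAt.eventually_lt continuousAt_const ?_
    simpa [hPz] using hrp
  obtain ⟨δ, hδr, hδ0, hδ1⟩ : ∃ δ, ‖Psi (z δ)‖ < r ∧ 0 < δ ∧ δ < 1 := by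
    have h1 : ∀ᶠ δ in nhdsWithin (0:ℝ) (Set.Ioi 0), ‖Psi (z δ)‖ < r := nhdsWithin_le_nhds hev
    have h2 : ∀ᶠ δ in nhdsWithin (0:ℝ) (Set.Ioi 0), δ ∈ Set.Ioo (0:ℝ) 1 :=
      Ioo_mem_nhdsGT one_pos
    obtain ⟨δ, h3, h4⟩ := (h1.and h2).exists
    exact ⟨δ, h3, h4.1, h4.2⟩
  have hfz : f (z δ) ≠ 0 := by
    have a1 : χ1 (Nu (z δ)) ≠ 0 := by
      rw [hzu δ (by linarith)]
      refine (χ1.pos_of_mem_ball ?_).ne'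
      rw [Metric.mem_ball, Real.dist_eq, abs_lt]
      have : χ1.rOut = 1 := rfl
      constructor <;> linarith
    have a2 : χ1 (Nv (z δ)) ≠ 0 := by
      rw [hzv δ (by linarith)]
      refine (χ1.pos_of_mem_ball ?_).ne'
      rw [Metric.mem_ball, Real.dist_eq, abs_lt]
      have : χ1.rOut = 1 := rfl
      constructor <;> linarith
    have a3 : β (Psi (z δ)) ≠ 0 := (β.pos_of_mem_ball (by simpa using hδr)).ne'
    have a4 : detL (rows Psi (z δ)) ≠ 0 := by
      rw [hdet]
      have hu := hzu δ (by linarith)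
      have hv := hzv δ (by linarith)
      rw [pb_zero (ρ := Nu (z δ)) (by linarith), pb'_zero (ρ := Nu (z δ)) (by linarith),
        pa_zero (ρ := Nv (z δ)) (by linarith), pa'_zero (ρ := Nv (z δ)) (by linarith)]
      refine (jm_i (pa_pos (by linarith)) ?_ (pb_pos (by linarith)) (pb'_nonneg _)).ne
      rw [hdot]
      exact pa_neg (ρ := Nu (z δ)) (by linarith) (by linarith)
    exact neg_ne_zero.2 (mul_ne_zero (mul_ne_zero (mul_ne_zero a1 a2) a3) a4)
  have hpos := hfc.integral_pos_of_hasCompactSupport_nonneg_nonzero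
    (μ := MeasureTheory.volume) hfs hf0 hfz
  have : ∫ x, f x = - ∫ x, χ x * β (Psi x) * detL (rows Psi x) :=
    MeasureTheory.integral_neg _
  rw [this, ← hHI, hL] at hpos
  simp at hpos

end Main

section Cover

lemma ext_section {d : ℕ} {U : Set (Sph d × Sph d)} (hU : IsOpen U) (hs : IsMotionSection U)
    (g : Sph d × Sph d → ℝ) (hg : Continuous g) (hgU : ∀ p, p ∉ U → g p = 0) :
    ∃ G : (Sph d × Sph d) × ℝ → EuclideanSpace ℝ (Fin (d + 1)), Continuous G ∧
      (∀ p t, t ≤ 0 → G (p, t) = p.1) ∧ (∀ p t, 1 ≤ t → G (p, t) = p.2) ∧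
      ∀ p t, 1 / 2 ≤ g p → G (p, t) ≠ 0 := by
  classical
  obtain ⟨s, hs⟩ := hs
  let lam : Sph d × Sph d → ℝ := fun p => max 0 (min 1 (4 * g p - 1))
  have clam : Continuous lam := by fun_prop
  have hlamU : ∀ p, p ∉ U → lam p = 0 := by
    intro p hp
    simp only [lam, hgU p hp]; norm_num
  let pr : ℝ → I := fun t => Set.projIcc 0 1 zero_le_one t
  have cpr : Continuous pr := continuous_projIcc
  let A : (Sph d × Sph d) × ℝ → EuclideanSpace ℝ (Fin (d + 1)) := fun z =>
    if h : z.1 ∈ U then lam z.1 • ((s ⟨z.1, h⟩ (pr z.2) : Sph d) : EuclideanSpace ℝ (Fin (d + 1)))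
    else 0
  let B : (Sph d × Sph d) × ℝ → EuclideanSpace ℝ (Fin (d + 1)) := fun z =>
    (1 - lam z.1) • ((1 - (pr z.2 : ℝ)) • (z.1.1 : EuclideanSpace ℝ (Fin (d + 1)))
      + (pr z.2 : ℝ) • (z.1.2 : EuclideanSpace ℝ (Fin (d + 1))))
  have cB : Continuous B := by
    have a1 : Continuous fun z : (Sph d × Sph d) × ℝ => (pr z.2 : ℝ) :=
      continuous_subtype_val.comp (cpr.comp continuous_snd)
    have a2 : Continuous fun z : (Sph d × Sph d) × ℝ => lam z.1 := clam.comp continuous_fst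
    have a3 : Continuous fun z : (Sph d × Sph d) × ℝ => (z.1.1 : EuclideanSpace ℝ (Fin (d + 1))) :=
      continuous_subtype_val.comp (continuous_fst.comp continuous_fst)
    have a4 : Continuous fun z : (Sph d × Sph d) × ℝ => (z.1.2 : EuclideanSpace ℝ (Fin (d + 1))) :=
      continuous_subtype_val.comp (continuous_snd.comp continuous_fst)
    exact (continuous_const.sub a2).smul
      (((continuous_const.sub a1).smul a3).add (a1.smul a4))
  have cA : Continuous A := by
    rw [continuous_iff_continuousAt]
    rintro ⟨p, t⟩
    by_cases hp : p ∈ U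
    · have hopen : IsOpen ((Prod.fst : (Sph d × Sph d) × ℝ → _) ⁻¹' U) :=
        hU.preimage continuous_fst
      refine ContinuousOn.continuousAt (s := Prod.fst ⁻¹' U) ?_ (hopen.mem_nhds hp)
      rw [continuousOn_iff_continuous_restrict]
      have b1 : Continuous fun z : ((Prod.fst : (Sph d × Sph d) × ℝ → _) ⁻¹' U) =>
          (⟨z.1.1, z.2⟩ : U) :=
        Continuous.subtype_mk (continuous_fst.comp continuous_subtype_val) _
      have b2 : Continuous fun z : ((Prod.fst : (Sph d × Sph d) × ℝ → _) ⁻¹' U) => pr z.1.2 :=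
        cpr.comp (continuous_snd.comp continuous_subtype_val)
      have b3 : Continuous fun z : ((Prod.fst : (Sph d × Sph d) × ℝ → _) ⁻¹' U) =>
          s (⟨z.1.1, z.2⟩ : U) (pr z.1.2) :=
        (continuous_eval (F := C(I, Sph d))).comp ((s.continuous.comp b1).prodMk b2)
      have b4 : Continuous fun z : ((Prod.fst : (Sph d × Sph d) × ℝ → _) ⁻¹' U) => lam z.1.1 :=
        clam.comp (continuous_fst.comp continuous_subtype_val)
      refine (b4.smul (continuous_subtype_val.comp b3)).congr ?_
      intro z
      have hz : z.1.1 ∈ U := z.2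
      simp [A, hz]
    · have hlt : g p < 1 / 4 := by rw [hgU p hp]; norm_num
      have hev : ∀ᶠ z in nhds (p, t), g (Prod.fst z) < 1 / 4 :=
        (hg.comp continuous_fst).continuousAt.eventually_lt continuousAt_const hlt
      have : A =ᶠ[nhds (p, t)] fun _ => 0 := by
        filter_upwards [hev] with z hz
        have : lam z.1 = 0 := max_eq_left ((min_le_right _ _).trans (by linarith))
        simp [A, this]
      exact (continuousAt_congr this).2 continuousAt_const
  refine ⟨fun z => A z + B z, cA.add cB, ?_, ?_, ?_⟩
  · intro p t ht
    have h1 : pr t = 0 := Set.projIcc_of_le_left _ ht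
    by_cases hp : p ∈ U
    · simp only [A, B, hp, h1, dite_true, (hs ⟨p, hp⟩).1]
      simp only [Set.Icc.coe_zero]
      module
    · simp [A, B, hp, h1, hlamU p hp]
  · intro p t ht
    have h1 : pr t = 1 := Set.projIcc_of_right_le _ ht
    by_cases hp : p ∈ U
    · simp only [A, B, hp, h1, dite_true, (hs ⟨p, hp⟩).2]
      simp only [Set.Icc.coe_one]
      module
    · simp [A, B, hp, h1, hlamU p hp]
  · intro p t hgp
    have hp : p ∈ U := by
      by_contra h
      rw [hgU p h] at hgp; norm_num at hgp
    have hl : lam p = 1 := by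
      simp only [lam]
      rw [min_eq_left (by linarith)]; norm_num
    simp only [A, B, hp, hl, dite_true]
    simp only [sub_self, zero_smul, add_zero, one_smul]
    exact ne_zero_of_mem_unit_sphere _

theorem no_two_cover (d : ℕ) (hd : 2 ≤ d) (heven : Even d) (U0 U1 : Set (Sph d × Sph d))
    (h0 : IsOpen U0) (h1 : IsOpen U1) (hc : ∀ p, p ∈ U0 ∨ p ∈ U1)
    (hs0 : IsMotionSection U0) (hs1 : IsMotionSection U1) : False := by
  have hdis : Disjoint U0ᶜ U1ᶜ := by
    rw [Set.disjoint_left]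
    intro p hp hp'
    rcases hc p with h | h
    · exact hp h
    · exact hp' h
  obtain ⟨f, hf0, hf1, -⟩ := exists_continuous_zero_one_of_isClosed h0.isClosed_compl
    h1.isClosed_compl hdis
  obtain ⟨G0, c0, a0, b0, n0⟩ := ext_section h0 hs0 f f.continuous (fun p hp => hf0 hp)
  obtain ⟨G1, c1, a1, b1, n1⟩ := ext_section h1 hs1 (fun p => 1 - f p)
    (continuous_const.sub f.continuous) (fun p hp => by
      have : f p = 1 := hf1 hp
      simp [this])
  refine no_pair d hd heven G0 G1 c0 c1 a0 a1 b0 b1 fun p s t => ?_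
  rcases le_total (1 / 2) (f p) with h | h
  · exact Or.inl (n0 p s h)
  · exact Or.inr (n1 p t (by linarith))

lemma sec_of_map {d : ℕ} (U : Set (Sph d × Sph d))
    (L : (Sph d × Sph d) × I → EuclideanSpace ℝ (Fin (d + 1))) (hL : Continuous L)
    (hne : ∀ p ∈ U, ∀ t, L (p, t) ≠ 0) (h0 : ∀ p, L (p, 0) = p.1) (h1 : ∀ p, L (p, 1) = p.2) :
    IsMotionSection U := by
  have cL : Continuous fun z : U × I => L (z.1.1, z.2) :=
    hL.comp ((continuous_subtype_val.comp continuous_fst).prodMk continuous_snd)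
  let F : C(U × I, Sph d) := ⟨fun z => ⟨‖L (z.1.1, z.2)‖⁻¹ • L (z.1.1, z.2), by
    have := norm_ne_zero_iff.2 (hne z.1.1 z.1.2 z.2)
    rw [mem_sphere_zero_iff_norm, norm_smul, norm_inv, norm_norm, inv_mul_cancel₀ this]⟩, by
    refine Continuous.subtype_mk ?_ _
    exact (cL.norm.inv₀ fun z => norm_ne_zero_iff.2 (hne z.1.1 z.1.2 z.2)).smul cL⟩
  refine ⟨F.curry, fun p => ⟨?_, ?_⟩⟩
  · apply Subtype.ext
    show ‖L (p.1, 0)‖⁻¹ • L (p.1, 0) = _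
    rw [h0, norm_eq_of_mem_sphere]; simp
  · apply Subtype.ext
    show ‖L (p.1, 1)‖⁻¹ • L (p.1, 1) = _
    rw [h1, norm_eq_of_mem_sphere]; simp

lemma comb_ne {d : ℕ} {x y : EuclideanSpace ℝ (Fin (d + 1))} (hx : ‖x‖ = 1) (hy : ‖y‖ = 1)
    (h : x ≠ -y) {a b : ℝ} (ha : 0 ≤ a) (hb : 0 ≤ b) (hab : a + b = 1) : a • x + b • y ≠ 0 := by
  intro h2
  have h3 : a • x = -(b • y) := eq_neg_of_add_eq_zero_left h2
  have h4 := congrArg norm h3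
  rw [norm_neg, norm_smul, norm_smul, hx, hy, Real.norm_of_nonneg ha, Real.norm_of_nonneg hb] at h4
  have h5 : a ≠ 0 := by intro h0; linarith
  have h6 : b = a := by linarith
  subst h6
  rw [← smul_neg] at h3
  exact h (smul_right_injective _ h5 h3)

lemma sec_one {d : ℕ} :
    IsMotionSection {p : Sph d × Sph d | (p.1 : EuclideanSpace ℝ (Fin (d + 1))) ≠ -p.2} := by
  refine sec_of_map _ (fun z => (1 - (z.2 : ℝ)) • (z.1.1 : EuclideanSpace ℝ (Fin (d + 1)))
    + (z.2 : ℝ) • (z.1.2 : EuclideanSpace ℝ (Fin (d + 1)))) (by fun_prop) ?_ ?_ ?_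
  · rintro p hp t
    exact comb_ne (norm_eq_of_mem_sphere _) (norm_eq_of_mem_sphere _) hp
      (by linarith [t.2.2]) t.2.1 (by ring)
  · intro p; simp
  · intro p; simp

lemma sec_two {d : ℕ} (q : EuclideanSpace ℝ (Fin (d + 1))) (hq : ‖q‖ = 1) :
    IsMotionSection {p : Sph d × Sph d | (p.1 : EuclideanSpace ℝ (Fin (d + 1))) ≠ -q ∧
      (p.2 : EuclideanSpace ℝ (Fin (d + 1))) ≠ -q} := by
  refine sec_of_map _ (fun z =>
    max 0 (1 - 2 * (z.2 : ℝ)) • (z.1.1 : EuclideanSpace ℝ (Fin (d + 1)))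
    + (1 - |2 * (z.2 : ℝ) - 1|) • q
    + max 0 (2 * (z.2 : ℝ) - 1) • (z.1.2 : EuclideanSpace ℝ (Fin (d + 1)))) (by fun_prop) ?_ ?_ ?_
  · rintro p ⟨hp1, hp2⟩ t
    have t0 := t.2.1
    have t1 := t.2.2
    rcases le_total (2 * (t : ℝ)) 1 with h | h
    · have := comb_ne (norm_eq_of_mem_sphere p.1) hq hp1 (a := 1 - 2 * (t : ℝ)) (b := 2 * (t : ℝ))
        (by linarith) (by linarith) (by ring)
      simp only
      rw [max_eq_right (by linarith), max_eq_left (by linarith), abs_of_nonpos (by linarith)]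
      convert this using 1
      module
    · have := comb_ne (norm_eq_of_mem_sphere p.2) hq hp2 (a := 2 * (t : ℝ) - 1)
        (b := 2 - 2 * (t : ℝ)) (by linarith) (by linarith) (by ring)
      simp only
      rw [max_eq_left (by linarith), max_eq_right (by linarith), abs_of_nonneg (by linarith)]
      convert this using 1
      module
  · intro p; simp
  · intro p; norm_num

theorem three_cover (d : ℕ) (hd : 2 ≤ d) : HasTCCover (Sph d) 3 := by
  let q : EuclideanSpace ℝ (Fin (d + 1)) := EuclideanSpace.single 0 1
  let q' : EuclideanSpace ℝ (Fin (d + 1)) := EuclideanSpace.single (Fin.last d) 1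
  have hq : ‖q‖ = 1 := by simp [q]
  have hq' : ‖q'‖ = 1 := by simp [q']
  have h0l : (0 : Fin (d + 1)) ≠ Fin.last d := by
    intro h
    have := congrArg Fin.val h
    simp at this
    omega
  have n1 : q ≠ q' := by
    intro h
    have := congrArg (fun v : EuclideanSpace ℝ (Fin (d + 1)) => v 0) h
    simp [q, q', h0l] at this
  have n2 : q ≠ -q' := by
    intro h
    have := congrArg (fun v : EuclideanSpace ℝ (Fin (d + 1)) => v 0) h
    simp [q, q', h0l] at this
  have o1 : ∀ v : EuclideanSpace ℝ (Fin (d + 1)), IsOpen {p : Sph d × Sph d |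
      (p.1 : EuclideanSpace ℝ (Fin (d + 1))) ≠ -v ∧
      (p.2 : EuclideanSpace ℝ (Fin (d + 1))) ≠ -v} := fun v =>
    (isOpen_ne_fun (by fun_prop) continuous_const).inter
      (isOpen_ne_fun (by fun_prop) continuous_const)
  refine ⟨![{p | (p.1 : EuclideanSpace ℝ (Fin (d + 1))) ≠ -p.2},
    {p | (p.1 : EuclideanSpace ℝ (Fin (d + 1))) ≠ -q ∧
      (p.2 : EuclideanSpace ℝ (Fin (d + 1))) ≠ -q},
    {p | (p.1 : EuclideanSpace ℝ (Fin (d + 1))) ≠ -q' ∧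
      (p.2 : EuclideanSpace ℝ (Fin (d + 1))) ≠ -q'}], ?_, ?_, ?_⟩
  · intro i
    fin_cases i
    · exact isOpen_ne_fun (by fun_prop) (by fun_prop)
    · exact o1 q
    · exact o1 q'
  · rw [Set.eq_univ_iff_forall]
    rintro ⟨x, y⟩
    rw [Set.mem_iUnion]
    by_cases hxy : (x : EuclideanSpace ℝ (Fin (d + 1))) = -y
    · by_cases hx : (x : EuclideanSpace ℝ (Fin (d + 1))) ≠ -q ∧
        (y : EuclideanSpace ℝ (Fin (d + 1))) ≠ -q
      · exact ⟨1, hx⟩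
      · refine ⟨2, ?_⟩
        show (x : EuclideanSpace ℝ (Fin (d + 1))) ≠ -q' ∧
          (y : EuclideanSpace ℝ (Fin (d + 1))) ≠ -q'
        rw [not_and_or, not_not, not_not] at hx
        rcases hx with hx | hx
        · have hy : (y : EuclideanSpace ℝ (Fin (d + 1))) = q := by
            rw [hx] at hxy; exact (neg_injective hxy).symm
          rw [hx, hy]
          exact ⟨fun h => n1 (neg_injective h), n2⟩
        · rw [hxy, hx, neg_neg]
          exact ⟨n2, fun h => n1 (neg_injective h)⟩
    · exact ⟨0, hxy⟩
  · intro i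
    fin_cases i
    · exact sec_one
    · exact sec_two q hq
    · exact sec_two q' hq'

end Cover

/-- For even `d ≥ 2`, the topological complexity of `S^d` is `3`. -/
theorem tc_even_sphere (d : ℕ) (hd : 2 ≤ d) (heven : Even d) :
    topologicalComplexity (Metric.sphere (0 : EuclideanSpace ℝ (Fin (d + 1))) 1) = 3 := by
  apply le_antisymm
  · exact sInf_le ⟨3, ⟨by norm_num, three_cover d hd⟩, rfl⟩
  · refine le_sInf ?_
    rintro _ ⟨k, ⟨hk1, U, hUo, hUc, hUs⟩, rfl⟩
    by_contra hlt
    have hk : k < 3 := by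
      have := not_le.1 hlt
      exact_mod_cast this
    have hcov : ∀ p, ∃ i, p ∈ U i := fun p => by
      have : p ∈ ⋃ i, U i := by rw [hUc]; trivial
      exact Set.mem_iUnion.1 this
    interval_cases k
    · refine no_two_cover d hd heven (U 0) (U 0) (hUo 0) (hUo 0) (fun p => ?_) (hUs 0) (hUs 0)
      obtain ⟨i, hi⟩ := hcov p
      fin_cases i
      exact Or.inl hi
    · refine no_two_cover d hd heven (U 0) (U 1) (hUo 0) (hUo 1) (fun p => ?_) (hUs 0) (hUs 1)
      obtain ⟨i, hi⟩ := hcov p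
      fin_cases i
      · exact Or.inl hi
      · exact Or.inr hi
end
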